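/- arXiv:0908.2461 — 4 statements merged into one kernel-verified Lean document; each statement's English description precedes it below -/
import Mathlib

section
/- Let S and S' be isotropic subspaces of V such that dim(S ∩ U) = dim(S' ∩ U), dim(S ∩ W) = dim(S' ∩ W), dim Rad(proj_U S) = dim Rad(proj_U S'), and dim proj_U S = dim proj_U S'. Then there exists a linear automorphism g of V with B(g x, g y) = B(x, y) for all x, y ∈ V, g(U) = U, g(W) = W, and g(S) = S'. -/
open Module

/-- The projection of `S` onto `A` along the complement `C`: `(S + C) ⊓ A`. -/
def projAlong {k V : Type*} [Field k] [AddCommGroup V] [Module k V]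
    (C A S : Submodule k V) : Submodule k V := (S ⊔ C) ⊓ A

/-- The radical of `T` with respect to `B`: `T ⊓ T^⊥`. -/
def bilinRad {k V : Type*} [Field k] [AddCommGroup V] [Module k V]
    (B : LinearMap.BilinForm k V) (T : Submodule k V) : Submodule k V :=
  T ⊓ B.orthogonal T

section LinearAlgebra

variable {k V X Y : Type*} [Field k] [AddCommGroup V] [Module k V]
  [AddCommGroup X] [Module k X] [AddCommGroup Y] [Module k Y]

theorem exists_linearMap_eq_of_disjoint {P Q : Submodule k V} (h : Disjoint P Q)
    (f g : V →ₗ[k] X) :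
    ∃ F : V →ₗ[k] X, (∀ x ∈ P, F x = f x) ∧ ∀ x ∈ Q, F x = g x := by
  obtain ⟨C, hPC, hC⟩ := h.exists_isCompl
  refine ⟨LinearMap.ofIsCompl hC (f.domRestrict C) (g.domRestrict Q),
    fun x hx => ?_, fun x hx => ?_⟩
  · exact LinearMap.ofIsCompl_apply_left hC ⟨x, hPC hx⟩
  · exact LinearMap.ofIsCompl_apply_right hC ⟨x, hx⟩

theorem exists_linearMap_comp_eq_on (S : Submodule k V) (a : V →ₗ[k] X) (b : V →ₗ[k] Y)
    (h : ∀ s ∈ S, a s = 0 → b s = 0) :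
    ∃ F : X →ₗ[k] Y, ∀ s ∈ S, F (a s) = b s := by
  have hker : LinearMap.ker (a.domRestrict S) ≤ LinearMap.ker (b.domRestrict S) :=
    fun s hs => h s s.2 hs
  obtain ⟨F, hF⟩ := LinearMap.exists_extend
    (((LinearMap.ker (a.domRestrict S)).liftQ (b.domRestrict S) hker).comp
      ((a.domRestrict S).quotKerEquivRange.symm :
        LinearMap.range (a.domRestrict S) →ₗ[k] S ⧸ LinearMap.ker (a.domRestrict S)))
  refine ⟨F, fun s hs => ?_⟩
  have := LinearMap.congr_fun hF ⟨a s, ⟨⟨s, hs⟩, rfl⟩⟩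
  have h2 := (a.domRestrict S).quotKerEquivRange_symm_apply_image ⟨s, hs⟩ ⟨⟨s, hs⟩, rfl⟩
  simp only [LinearMap.comp_apply, Submodule.subtype_apply, LinearEquiv.coe_coe] at this
  rw [this]
  erw [h2]
  rfl

theorem exists_disjoint_sup_eq {P Q : Submodule k V} (h : P ≤ Q) :
    ∃ D : Submodule k V, Disjoint P D ∧ P ⊔ D = Q := by
  obtain ⟨C, hC⟩ := Submodule.exists_isCompl P
  refine ⟨C ⊓ Q, hC.disjoint.mono_right inf_le_left, ?_⟩
  rw [← sup_inf_assoc_of_le C h, hC.sup_eq_top, top_inf_eq]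

theorem finrank_sup_of_disjoint [FiniteDimensional k V] {P Q : Submodule k V} (h : Disjoint P Q) :
    finrank k (P ⊔ Q : Submodule k V) = finrank k P + finrank k Q := by
  have := Submodule.finrank_sup_add_finrank_inf_eq P Q
  rwa [h.eq_bot, finrank_bot, add_zero] at this

theorem exists_linearMap_map_eq [FiniteDimensional k V] {P Q : Submodule k V}
    (h : finrank k P = finrank k Q) :
    ∃ F : V →ₗ[k] V, P.map F = Q := by
  obtain ⟨F, hF⟩ := LinearMap.exists_extend
    (Q.subtype ∘ₗ (LinearEquiv.ofFinrankEq P Q h : P →ₗ[k] Q))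
  refine ⟨F, ?_⟩
  have := congrArg LinearMap.range hF
  rwa [LinearMap.range_comp, LinearMap.range_comp, Submodule.range_subtype, LinearEquiv.range,
    Submodule.map_top, Submodule.range_subtype] at this

theorem finrank_map_add_finrank_inf_ker [FiniteDimensional k V] (f : V →ₗ[k] X)
    (P : Submodule k V) :
    finrank k (P.map f) + finrank k (P ⊓ LinearMap.ker f : Submodule k V) = finrank k P := by
  have := (f.domRestrict P).finrank_range_add_finrank_ker
  rw [LinearMap.range_domRestrict, LinearMap.ker_domRestrict] at this
  rw [← this,
    LinearEquiv.finrank_eq (Submodule.equivSubtypeMap P ((LinearMap.ker f).comap P.subtype)),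
    Submodule.map_comap_subtype]

theorem injOn_of_map_eq_of_finrank_eq [FiniteDimensional k V] {f : V →ₗ[k] X}
    {P : Submodule k V} (h : finrank k (P.map f) = finrank k P) :
    ∀ x ∈ P, f x = 0 → x = 0 := by
  have h1 := finrank_map_add_finrank_inf_ker f P
  have h2 : P ⊓ LinearMap.ker f = ⊥ := Submodule.finrank_eq_zero.mp (by omega)
  intro x hx hfx
  have : x ∈ P ⊓ LinearMap.ker f := ⟨hx, hfx⟩
  simpa [h2] using this

theorem exists_linearMap_sup_span_isometry {B : LinearMap.BilinForm k V}
    (hBsymm : ∀ x y : V, B x y = B y x) {P : Submodule k V} {f : V →ₗ[k] V}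
    (hinj : ∀ x ∈ P, f x = 0 → x = 0) (hf : ∀ x ∈ P, ∀ y ∈ P, B (f x) (f y) = B x y)
    {z z' : V} (hz : z ∉ P) (hz' : z' ∉ P.map f) (hzz' : ∀ x ∈ P, B z' (f x) = B z x)
    (hself : B z' z' = B z z) :
    ∃ F : V →ₗ[k] V, (∀ x ∈ P, F x = f x) ∧
      (∀ x ∈ P ⊔ Submodule.span k {z}, F x = 0 → x = 0) ∧
      ∀ x ∈ P ⊔ Submodule.span k {z}, ∀ y ∈ P ⊔ Submodule.span k {z}, B (F x) (F y) = B x y := by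
  obtain ⟨φ, hφz, hφP⟩ := Submodule.exists_le_ker_of_notMem hz
  replace hφP : ∀ x ∈ P, φ x = 0 := fun x hx => hφP hx
  obtain ⟨F, hFP, hFz⟩ : ∃ F : V →ₗ[k] V, (∀ x ∈ P, F x = f x) ∧ F z = z' := by
    refine ⟨f + φ.smulRight ((φ z)⁻¹ • (z' - f z)), fun x hx => ?_, ?_⟩
    · simp [hφP x hx]
    · simp [smul_smul, hφz]
  have hmem : ∀ x ∈ P ⊔ Submodule.span k {z}, ∃ p ∈ P, ∃ c : k, x = p + c • z := by
    intro x hx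
    obtain ⟨p, hp, q, hq, rfl⟩ := Submodule.mem_sup.1 hx
    obtain ⟨c, rfl⟩ := Submodule.mem_span_singleton.1 hq
    exact ⟨p, hp, c, rfl⟩
  refine ⟨F, hFP, ?_, ?_⟩
  · intro x hx h0
    obtain ⟨p, hp, c, rfl⟩ := hmem x hx
    rw [map_add, map_smul, hFP p hp, hFz] at h0
    have hc : c = 0 := by
      by_contra hc
      refine hz' ⟨-c⁻¹ • p, P.smul_mem _ hp, ?_⟩
      rw [map_smul, eq_neg_of_add_eq_zero_left h0, smul_neg, neg_smul, neg_neg, smul_smul,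
        inv_mul_cancel₀ hc, one_smul]
    subst hc
    rw [zero_smul, add_zero] at h0 ⊢
    exact hinj p hp h0
  · intro x hx y hy
    obtain ⟨p, hp, c, rfl⟩ := hmem x hx
    obtain ⟨q, hq, d, rfl⟩ := hmem y hy
    simp only [map_add, map_smul, LinearMap.add_apply, LinearMap.smul_apply, hFP p hp, hFP q hq,
      hFz, hf p hp q hq, hzz' q hq, hself, hBsymm (f p) z', hzz' p hp, hBsymm p z]

theorem exists_forall_apply_eq_dual [FiniteDimensional k V] {B : LinearMap.BilinForm k V}
    (hBnd : ∀ x : V, (∀ y : V, B x y = 0) → x = 0) (φ : Dual k V) :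
    ∃ z, ∀ x, B z x = φ x := by
  have hinj : Function.Injective (B : V →ₗ[k] Dual k V) := by
    rw [injective_iff_map_eq_zero]
    exact fun x hx => hBnd x fun y => by rw [hx]; rfl
  obtain ⟨z, hz⟩ := (LinearMap.injective_iff_surjective_of_finrank_eq_finrank
    (Subspace.dual_finrank_eq (K := k) (V := V)).symm).1 hinj φ
  exact ⟨z, fun x => by rw [hz]⟩

end LinearAlgebra

section Witt

variable {k V : Type*} [Field k] [IsAlgClosed k] [AddCommGroup V] [Module k V]
  [FiniteDimensional k V]

theorem exists_isometry_map_eq_of_nondegenerate (hchar : (2 : k) ≠ 0)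
    (B : LinearMap.BilinForm k V) (hBsymm : ∀ x y : V, B x y = B y x) {N N' : Submodule k V}
    (hN : ∀ x ∈ N, (∀ y ∈ N, B x y = 0) → x = 0)
    (hN' : ∀ x ∈ N', (∀ y ∈ N', B x y = 0) → x = 0) (h : finrank k N = finrank k N') :
    ∃ F : V →ₗ[k] V, N.map F = N' ∧ ∀ x ∈ N, ∀ y ∈ N, B (F x) (F y) = B x y := by
  let _ : Invertible (2 : k) := invertibleOfNonzero hchar
  have key : ∀ P : Submodule k V, (∀ x ∈ P, (∀ y ∈ P, B x y = 0) → x = 0) →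
      QuadraticMap.Equivalent (LinearMap.BilinMap.toQuadraticMap (B.restrict P))
        (QuadraticMap.weightedSumSquares k (1 : Fin (finrank k P) → k)) := by
    intro P hP
    apply QuadraticForm.equivalent_weightedSumSquares_of_isAlgClosed
    rw [QuadraticMap.associated_left_inverse]
    · intro x hx
      exact Subtype.ext (hP x x.2 fun y hy => hx ⟨y, hy⟩)
    · exact fun x y => hBsymm x y
  have h1 := key N hN
  have h2 := key N' hN'
  rw [← h] at h2
  obtain ⟨e⟩ := h1.trans h2.symm
  have he : ∀ x : N, B (e x) (e x) = B x x := fun x => e.map_app x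
  obtain ⟨F, hF⟩ := LinearMap.exists_extend (N'.subtype ∘ₗ (e.toLinearEquiv : N →ₗ[k] N'))
  have hF' : ∀ x : N, F x = e x := fun x => LinearMap.congr_fun hF x
  refine ⟨F, ?_, ?_⟩
  · have := congrArg LinearMap.range hF
    rwa [LinearMap.range_comp, LinearMap.range_comp, Submodule.range_subtype, LinearEquiv.range,
      Submodule.map_top, Submodule.range_subtype] at this
  · have hq : ∀ x ∈ N, B (F x) (F x) = B x x := fun x hx => by
      rw [hF' ⟨x, hx⟩]; exact he ⟨x, hx⟩
    intro x hx y hy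
    have h3 := hq (x + y) (N.add_mem hx hy)
    simp only [map_add, LinearMap.add_apply, hq x hx, hq y hy, hBsymm (F y) (F x),
      hBsymm y x] at h3
    exact mul_left_cancel₀ hchar (by linear_combination h3)

theorem exists_orthogonal_apply_self_eq_one (hchar : (2 : k) ≠ 0)
    {B : LinearMap.BilinForm k V} (hBsymm : ∀ x y : V, B x y = B y x)
    (hBnd : ∀ x : V, (∀ y : V, B x y = 0) → x = 0) {P : Submodule k V}
    (hP : ∀ x ∈ P, (∀ y ∈ P, B x y = 0) → x = 0) (htop : P ≠ ⊤) :
    ∃ z, (∀ x ∈ P, B z x = 0) ∧ B z z = 1 := by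
  have hrefl : B.IsRefl := fun x y hxy => by rw [hBsymm, hxy]
  have hcompl : IsCompl P (B.orthogonal P) := by
    rw [LinearMap.BilinForm.isCompl_orthogonal_iff_disjoint hrefl, Submodule.disjoint_def]
    exact fun x hx hx' => hP x hx fun y hy => by rw [hBsymm]; exact hx' y hy
  obtain ⟨w, hw, hww⟩ : ∃ w ∈ B.orthogonal P, B w w ≠ 0 := by
    by_contra! hall
    have hbot : B.orthogonal P = ⊥ := by
      rw [Submodule.eq_bot_iff]
      intro x hx
      apply hBnd
      intro y
      obtain ⟨p, hp, q, hq, rfl⟩ :=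
        Submodule.mem_sup.1 (hcompl.sup_eq_top ▸ Submodule.mem_top (x := y))
      have h1 : B x p = 0 := by rw [hBsymm]; exact hx p hp
      have h2 := hall _ (Submodule.add_mem _ hx hq)
      simp only [map_add, LinearMap.add_apply, hall x hx, hall q hq, hBsymm q x] at h2
      rw [map_add, h1, zero_add]
      exact mul_left_cancel₀ hchar (by linear_combination h2)
    have := hcompl.sup_eq_top
    rw [hbot, sup_bot_eq] at this
    exact htop this
  obtain ⟨c, hc⟩ := IsAlgClosed.exists_pow_nat_eq (B w w) (n := 2) (by norm_num)
  have hc0 : c ≠ 0 := by rintro rfl; simp at hc; exact hww hc.symm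
  refine ⟨c⁻¹ • w, fun x hx => ?_, ?_⟩
  · rw [map_smul, LinearMap.smul_apply, hBsymm, show B x w = 0 from hw x hx, smul_zero]
  · simp only [map_smul, LinearMap.smul_apply, smul_eq_mul, ← hc]
    field_simp

theorem exists_isometry_extension_vector (hchar : (2 : k) ≠ 0) {B : LinearMap.BilinForm k V}
    (hBsymm : ∀ x y : V, B x y = B y x)
    (hBnd : ∀ x : V, (∀ y : V, B x y = 0) → x = 0) {P : Submodule k V} {f : V →ₗ[k] V}
    (hinj : ∀ x ∈ P, f x = 0 → x = 0) (hf : ∀ x ∈ P, ∀ y ∈ P, B (f x) (f y) = B x y)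
    (htop : P ≠ ⊤) :
    ∃ z z', z ∉ P ∧ z' ∉ P.map f ∧ (∀ x ∈ P, B z' (f x) = B z x) ∧ B z' z' = B z z := by
  by_cases hP : ∀ x ∈ P, (∀ y ∈ P, B x y = 0) → x = 0
  · have hP' : ∀ x ∈ P.map f, (∀ y ∈ P.map f, B x y = 0) → x = 0 := by
      rintro _ ⟨x, hx, rfl⟩ h
      rw [hP x hx fun y hy => by rw [← hf x hx y hy]; exact h _ ⟨y, hy, rfl⟩, map_zero]
    have htop' : P.map f ≠ ⊤ := fun h => htop <| Submodule.eq_top_of_finrank_eq <| by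
      refine le_antisymm (Submodule.finrank_le P) ?_
      rw [← finrank_top k V, ← h]
      exact Submodule.finrank_map_le f P
    obtain ⟨z, hz, hzz⟩ := exists_orthogonal_apply_self_eq_one hchar hBsymm hBnd hP htop
    obtain ⟨z', hz', hzz'⟩ := exists_orthogonal_apply_self_eq_one hchar hBsymm hBnd hP' htop'
    refine ⟨z, z', fun h => ?_, fun h => ?_, fun x hx => ?_, hzz'.trans hzz.symm⟩
    · exact one_ne_zero (hzz.symm.trans (hz z h))
    · exact one_ne_zero (hzz'.symm.trans (hz' z' h))
    · rw [hz x hx, hz' _ ⟨x, hx, rfl⟩]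
  · push Not at hP
    obtain ⟨v, hv, hvP, hv0⟩ := hP
    obtain ⟨z, hz⟩ : ∃ z, B v z ≠ 0 := by
      by_contra! h
      exact hv0 (hBnd v h)
    rw [hBsymm] at hz
    obtain ⟨ψ, hψ⟩ := exists_linearMap_comp_eq_on P f (B z) fun s hs h0 => by
      rw [hinj s hs h0, map_zero]
    obtain ⟨w, hw⟩ := exists_forall_apply_eq_dual hBnd ψ
    have hwf : ∀ x ∈ P, B w (f x) = B z x := fun x hx => (hw _).trans (hψ x hx)
    have hpair : ∀ c : k, ∀ x ∈ P, B (w + c • f v) (f x) = B z x := fun c x hx => by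
      rw [map_add, map_smul, LinearMap.add_apply, LinearMap.smul_apply, hf v hv x hx, hvP x hx,
        smul_zero, add_zero, hwf x hx]
    refine ⟨z, w + ((B z z - B w w) / (2 * B z v)) • f v, fun h => ?_, ?_, hpair _, ?_⟩
    · exact hz (by rw [hBsymm]; exact hvP z h)
    · rintro ⟨x, hx, hxw⟩
      apply hz
      rw [← hpair _ v hv, ← hxw, hf x hx v hv, hBsymm]
      exact hvP x hx
    · simp only [map_add, map_smul, LinearMap.add_apply, LinearMap.smul_apply, smul_eq_mul,
        hf v hv v hv, hvP v hv, hBsymm (f v) w, hwf v hv]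
      field_simp
      ring

/-- Witt's extension theorem over an algebraically closed field. -/
theorem exists_isometry_extension (hchar : (2 : k) ≠ 0) {B : LinearMap.BilinForm k V}
    (hBsymm : ∀ x y : V, B x y = B y x)
    (hBnd : ∀ x : V, (∀ y : V, B x y = 0) → x = 0) (P : Submodule k V) (f : V →ₗ[k] V)
    (hinj : ∀ x ∈ P, f x = 0 → x = 0) (hf : ∀ x ∈ P, ∀ y ∈ P, B (f x) (f y) = B x y) :
    ∃ g : V ≃ₗ[k] V, (∀ x y : V, B (g x) (g y) = B x y) ∧ ∀ x ∈ P, g x = f x := by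
  induction P using WellFoundedGT.induction generalizing f with
  | ind P ih =>
    by_cases htop : P = ⊤
    · subst htop
      have : Function.Injective f :=
        (injective_iff_map_eq_zero f).2 fun x => hinj x Submodule.mem_top
      exact ⟨LinearEquiv.ofInjectiveEndo f this,
        fun x y => hf x Submodule.mem_top y Submodule.mem_top, fun x _ => rfl⟩
    · obtain ⟨z, z', hz, hz', hzz', hself⟩ :=
        exists_isometry_extension_vector hchar hBsymm hBnd hinj hf htop
      obtain ⟨F, hFP, hFinj, hF⟩ :=
        exists_linearMap_sup_span_isometry hBsymm hinj hf hz hz' hzz' hself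
      have hlt : P < P ⊔ Submodule.span k {z} := lt_of_le_of_ne le_sup_left fun h =>
        hz (h ▸ Submodule.mem_sup_right (Submodule.mem_span_singleton_self z))
      obtain ⟨g, hg, hgF⟩ := ih _ hlt F hFinj hF
      exact ⟨g, hg, fun x hx => (hgF x (le_sup_left (a := P) hx)).trans (hFP x hx)⟩

end Witt

section Orbits

variable {k V : Type*} [Field k] [AddCommGroup V] [Module k V]

theorem map_eq_map_of_forall_mem_eq {P : Submodule k V} {f g : V →ₗ[k] V}
    (h : ∀ x ∈ P, f x = g x) : P.map f = P.map g :=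
  SetLike.coe_injective (by simpa only [Submodule.map_coe] using Set.image_congr h)

theorem mem_bilinRad {B : LinearMap.BilinForm k V} {S : Submodule k V} {x : V} :
    x ∈ bilinRad B S ↔ x ∈ S ∧ ∀ y ∈ S, B y x = 0 := Iff.rfl

variable [FiniteDimensional k V]

theorem exists_isometry_map_eq_of_le_bilinRad [IsAlgClosed k] (hchar : (2 : k) ≠ 0)
    (B : LinearMap.BilinForm k V) (hBsymm : ∀ x y : V, B x y = B y x)
    {S S' A A' C C' : Submodule k V} (hAC : Disjoint A C) (hAC' : Disjoint A' C')
    (hA : A ≤ bilinRad B S) (hC : C ≤ bilinRad B S)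
    (hA' : A' ≤ bilinRad B S') (hC' : C' ≤ bilinRad B S')
    (hdA : finrank k A = finrank k A') (hdC : finrank k C = finrank k C')
    (hdR : finrank k (bilinRad B S) = finrank k (bilinRad B S'))
    (hdS : finrank k S = finrank k S') :
    ∃ h : V →ₗ[k] V, S.map h = S' ∧ A.map h = A' ∧ C.map h = C' ∧
      ∀ x ∈ S, ∀ y ∈ S, B (h x) (h y) = B x y := by
  obtain ⟨D, hD, hDR⟩ := exists_disjoint_sup_eq (sup_le hA hC)
  obtain ⟨D', hD', hDR'⟩ := exists_disjoint_sup_eq (sup_le hA' hC')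
  obtain ⟨N, hN, hNS⟩ := exists_disjoint_sup_eq (show bilinRad B S ≤ S from inf_le_left)
  obtain ⟨N', hN', hNS'⟩ := exists_disjoint_sup_eq (show bilinRad B S' ≤ S' from inf_le_left)
  have hdD : finrank k D = finrank k D' := by
    have e1 := finrank_sup_of_disjoint hD
    have e2 := finrank_sup_of_disjoint hD'
    rw [hDR, finrank_sup_of_disjoint hAC] at e1
    rw [hDR', finrank_sup_of_disjoint hAC'] at e2
    omega
  have hdN : finrank k N = finrank k N' := by
    have e1 := finrank_sup_of_disjoint hN
    have e2 := finrank_sup_of_disjoint hN'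
    rw [hNS] at e1
    rw [hNS'] at e2
    omega
  have hnondeg : ∀ {T M : Submodule k V}, Disjoint (bilinRad B T) M → bilinRad B T ⊔ M = T →
      ∀ x ∈ M, (∀ y ∈ M, B x y = 0) → x = 0 := by
    intro T M hM hMT x hx hxM
    refine Submodule.disjoint_def.1 hM x ⟨hMT ▸ Submodule.mem_sup_right hx, fun t ht => ?_⟩ hx
    obtain ⟨r, hr, m, hm, rfl⟩ := Submodule.mem_sup.1 (hMT.symm ▸ ht : t ∈ bilinRad B T ⊔ M)
    change B (r + m) x = 0
    rw [map_add, LinearMap.add_apply, hBsymm m, hxM m hm, add_zero, hBsymm]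
    exact hr.2 x (hMT ▸ Submodule.mem_sup_right hx)
  obtain ⟨fA, hfA⟩ := exists_linearMap_map_eq hdA
  obtain ⟨fC, hfC⟩ := exists_linearMap_map_eq hdC
  obtain ⟨fD, hfD⟩ := exists_linearMap_map_eq hdD
  obtain ⟨fN, hfN, hfNB⟩ := exists_isometry_map_eq_of_nondegenerate hchar B hBsymm
    (hnondeg hN hNS) (hnondeg hN' hNS') hdN
  obtain ⟨f₁, h₁A, h₁C⟩ := exists_linearMap_eq_of_disjoint hAC fA fC
  obtain ⟨f₂, h₂AC, h₂D⟩ := exists_linearMap_eq_of_disjoint hD f₁ fD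
  obtain ⟨f, hfR, hfN'⟩ := exists_linearMap_eq_of_disjoint hN f₂ fN
  have hmapA : A.map f = A' := by
    rw [← hfA]
    exact map_eq_map_of_forall_mem_eq fun x hx => by
      rw [hfR x (hA hx), h₂AC x (Submodule.mem_sup_left hx), h₁A x hx]
  have hmapC : C.map f = C' := by
    rw [← hfC]
    exact map_eq_map_of_forall_mem_eq fun x hx => by
      rw [hfR x (hC hx), h₂AC x (Submodule.mem_sup_right hx), h₁C x hx]
  have hmapD : D.map f = D' := by
    rw [← hfD]
    exact map_eq_map_of_forall_mem_eq fun x hx => by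
      rw [hfR x (hDR ▸ Submodule.mem_sup_right hx), h₂D x hx]
  have hmapN : N.map f = N' := by
    rw [← hfN]
    exact map_eq_map_of_forall_mem_eq hfN'
  have hmapR : (bilinRad B S).map f = bilinRad B S' := by
    rw [← hDR, ← hDR', Submodule.map_sup, Submodule.map_sup, hmapA, hmapC, hmapD]
  have hmapS : S.map f = S' := by
    conv_lhs => rw [← hNS]
    conv_rhs => rw [← hNS']
    rw [Submodule.map_sup, hmapR, hmapN]
  refine ⟨f, hmapS, hmapA, hmapC, ?_⟩
  have hrad : ∀ r ∈ bilinRad B S, ∀ y ∈ S, B y r = 0 ∧ B (f y) (f r) = 0 := by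
    intro r hr y hy
    have hfr : f r ∈ bilinRad B S' := hmapR ▸ Submodule.mem_map_of_mem hr
    exact ⟨hr.2 y hy, hfr.2 _ (hmapS ▸ Submodule.mem_map_of_mem hy)⟩
  intro x hx y hy
  obtain ⟨r, hr, n, hn, rfl⟩ := Submodule.mem_sup.1 (hNS.symm ▸ hx : x ∈ bilinRad B S ⊔ N)
  obtain ⟨r', hr', n', hn', rfl⟩ := Submodule.mem_sup.1 (hNS.symm ▸ hy : y ∈ bilinRad B S ⊔ N)
  rw [map_add f r', map_add (B _), map_add (B _), (hrad r' hr' _ hx).1, (hrad r' hr' _ hx).2,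
    map_add f r, map_add B, map_add B, LinearMap.add_apply, LinearMap.add_apply, hBsymm r,
    hBsymm (f r),
    (hrad r hr _ (hNS ▸ Submodule.mem_sup_right hn')).1,
    (hrad r hr _ (hNS ▸ Submodule.mem_sup_right hn')).2, hfN' n hn, hfN' n' hn', hfNB n hn n' hn']

theorem exists_isometry_apply_projection_eq [IsAlgClosed k] (hchar : (2 : k) ≠ 0)
    {B : LinearMap.BilinForm k V} (hBsymm : ∀ x y : V, B x y = B y x)
    (hBnd : ∀ x : V, (∀ y : V, B x y = 0) → x = 0) {π : V →ₗ[k] V} (hπ : ∀ x, π (π x) = π x)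
    (hadj : ∀ x y, B (π x) y = B x (π y)) {S : Submodule k V} {h : V →ₗ[k] V}
    (hzero : ∀ s ∈ S, π (h s) = 0 ↔ π s = 0)
    (hiso : ∀ s ∈ S, ∀ t ∈ S, B (π (h s)) (π (h t)) = B (π s) (π t)) :
    ∃ g : V ≃ₗ[k] V, (∀ x y : V, B (g x) (g y) = B x y) ∧ (∀ x, π x = 0 → g x = x) ∧
      (∀ x, π x = x → π (g x) = g x) ∧ ∀ s ∈ S, g (π s) = π (h s) := by
  obtain ⟨F, hF⟩ := exists_linearMap_comp_eq_on S π (π ∘ₗ h) fun s hs h0 => (hzero s hs).2 h0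
  replace hF : ∀ s ∈ S, F (π s) = π (h s) := hF
  set f : V →ₗ[k] V := F ∘ₗ π + (LinearMap.id - π) with hf
  have hfw : ∀ s ∈ S, ∀ w, π w = 0 → f (π s + w) = π (h s) + w := by
    intro s hs w hw
    simp [hf, hπ, hw, hF s hs]
  have hmem : ∀ x ∈ S.map π ⊔ LinearMap.ker π, ∃ s ∈ S, ∃ w, π w = 0 ∧ x = π s + w := by
    intro x hx
    obtain ⟨_, ⟨s, hs, rfl⟩, w, hw, rfl⟩ := Submodule.mem_sup.1 hx
    exact ⟨s, hs, w, hw, rfl⟩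
  have horth : ∀ x w, π w = 0 → B (π x) w = 0 := fun x w hw => by rw [hadj, hw, map_zero]
  obtain ⟨g, hg, hgf⟩ := exists_isometry_extension hchar hBsymm hBnd
    (S.map π ⊔ LinearMap.ker π) f
    (by
      intro x hx h0
      obtain ⟨s, hs, w, hw, rfl⟩ := hmem x hx
      rw [hfw s hs w hw] at h0
      have h1 : π (h s) = 0 := by simpa [hπ, hw] using congrArg π h0
      rw [h1, zero_add] at h0
      rw [(hzero s hs).1 h1, h0, add_zero])
    (by
      intro x hx y hy
      obtain ⟨s, hs, w, hw, rfl⟩ := hmem x hx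
      obtain ⟨t, ht, v, hv, rfl⟩ := hmem y hy
      rw [hfw s hs w hw, hfw t ht v hv]
      simp only [map_add, LinearMap.add_apply, hiso s hs t ht, horth _ _ hv,
        hBsymm w (π _), horth _ _ hw])
  have hgw : ∀ x, π x = 0 → g x = x := fun x hx => by
    rw [hgf x (Submodule.mem_sup_right hx)]
    simpa using hfw 0 S.zero_mem x hx
  refine ⟨g, hg, hgw, fun x hx => ?_, fun s hs => ?_⟩
  · refine (sub_eq_zero.1 (hBnd _ fun z => ?_)).symm
    have hw : π (z - π z) = 0 := by rw [map_sub, hπ, sub_self]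
    have : B (g x - π (g x)) z = B (g x) (g (z - π z)) := by
      rw [hgw _ hw, map_sub, map_sub, LinearMap.sub_apply, hadj]
    rw [this, hg, ← hx, horth _ _ hw]
  · rw [hgf _ (Submodule.mem_sup_left ⟨s, hs, rfl⟩)]
    simpa using hfw s hs 0 (map_zero π)

theorem exists_isometry_commuting_projection_map_eq [IsAlgClosed k] (hchar : (2 : k) ≠ 0)
    {B : LinearMap.BilinForm k V} (hBsymm : ∀ x y : V, B x y = B y x)
    (hBnd : ∀ x : V, (∀ y : V, B x y = 0) → x = 0) {π : V →ₗ[k] V} (hπ : ∀ x, π (π x) = π x)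
    (hadj : ∀ x y, B (π x) y = B x (π y)) {S S' : Submodule k V}
    (hS : ∀ s ∈ S, ∀ t ∈ S, B s t = 0) (hS' : ∀ s ∈ S', ∀ t ∈ S', B s t = 0)
    (hdU : finrank k (S ⊓ LinearMap.ker (LinearMap.id - π) : Submodule k V) =
      finrank k (S' ⊓ LinearMap.ker (LinearMap.id - π) : Submodule k V))
    (hdW : finrank k (S ⊓ LinearMap.ker π : Submodule k V) =
      finrank k (S' ⊓ LinearMap.ker π : Submodule k V))
    (hdR : finrank k (bilinRad (B.comp π π) S) = finrank k (bilinRad (B.comp π π) S'))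
    (hdS : finrank k S = finrank k S') :
    ∃ g : V ≃ₗ[k] V, (∀ x y : V, B (g x) (g y) = B x y) ∧ (∀ x, π x = x → π (g x) = g x) ∧
      (∀ x, π x = 0 → π (g x) = 0) ∧ S.map (g : V →ₗ[k] V) = S' := by
  set ρ : V →ₗ[k] V := LinearMap.id - π with hρ
  have hρa : ∀ x, ρ x = x - π x := fun x => rfl
  have hρ0 : ∀ x, ρ x = 0 ↔ π x = x := fun x => by rw [hρa, sub_eq_zero, eq_comm]
  have hρ1 : ∀ x, ρ x = x ↔ π x = 0 := fun x => by rw [hρa, sub_eq_self]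
  have hρρ : ∀ x, ρ (ρ x) = ρ x := fun x => by
    rw [hρ1, hρa, map_sub, hπ, sub_self]
  have hρadj : ∀ x y, B (ρ x) y = B x (ρ y) := fun x y => by
    rw [hρa, hρa, map_sub, map_sub, LinearMap.sub_apply, hadj]
  have hadd : ∀ x, π x + ρ x = x := fun x => by rw [hρa]; abel
  have hsplit : ∀ {T : Submodule k V}, (∀ s ∈ T, ∀ t ∈ T, B s t = 0) → ∀ s ∈ T, ∀ t ∈ T,
      B (ρ s) (ρ t) = -B (π s) (π t) := by
    intro T hT s hs t ht
    have e1 : B (ρ s) (ρ t) = B s t - B s (π t) := by rw [hρadj, hρρ, hρa, map_sub]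
    have e2 : B (π s) (π t) = B s (π t) := by rw [hadj, hπ]
    rw [e1, e2, hT s hs t ht, zero_sub]
  have hdisj : Disjoint (LinearMap.ker ρ) (LinearMap.ker π) := by
    rw [Submodule.disjoint_def]
    intro x hx hx'
    rw [← (hρ0 x).1 hx, hx']
  have hleU : ∀ {T : Submodule k V}, (∀ s ∈ T, ∀ t ∈ T, B s t = 0) →
      T ⊓ LinearMap.ker ρ ≤ bilinRad (B.comp π π) T := by
    intro T hT x hx
    refine ⟨hx.1, fun t ht => ?_⟩
    change B (π t) (π x) = 0
    rw [hadj, hπ, (hρ0 x).1 hx.2, hT t ht x hx.1]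
  have hleW : ∀ T : Submodule k V, T ⊓ LinearMap.ker π ≤ bilinRad (B.comp π π) T := by
    intro T x hx
    refine ⟨hx.1, fun t ht => ?_⟩
    change B (π t) (π x) = 0
    rw [show π x = 0 from hx.2, map_zero]
  obtain ⟨h, hhS, hhU, hhW, hiso⟩ := exists_isometry_map_eq_of_le_bilinRad hchar (B.comp π π)
    (fun x y => hBsymm _ _) (hdisj.mono inf_le_right inf_le_right)
    (hdisj.mono inf_le_right inf_le_right) (hleU hS) (hleW S) (hleU hS') (hleW S') hdU hdW hdR hdS
  replace hiso : ∀ s ∈ S, ∀ t ∈ S, B (π (h s)) (π (h t)) = B (π s) (π t) := hiso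
  have hmemS' : ∀ s ∈ S, h s ∈ S' := fun s hs => hhS ▸ Submodule.mem_map_of_mem hs
  have hinj := injOn_of_map_eq_of_finrank_eq (f := h) (P := S) (by rw [hhS, hdS])
  have hzero : ∀ τ : V →ₗ[k] V, (S ⊓ LinearMap.ker τ).map h = S' ⊓ LinearMap.ker τ →
      ∀ s ∈ S, τ (h s) = 0 ↔ τ s = 0 := by
    intro τ hτ s hs
    constructor
    · intro h0
      obtain ⟨c, hc, hcs⟩ : h s ∈ (S ⊓ LinearMap.ker τ).map h := hτ ▸ ⟨hmemS' s hs, h0⟩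
      have := hinj (c - s) (S.sub_mem hc.1 hs) (by rw [map_sub, hcs, sub_self])
      rw [← sub_eq_zero.1 this]
      exact hc.2
    · intro h0
      have : h s ∈ S' ⊓ LinearMap.ker τ := hτ ▸ Submodule.mem_map_of_mem ⟨hs, h0⟩
      exact this.2
  obtain ⟨g₁, hg₁, hg₁W, hg₁U, hg₁S⟩ := exists_isometry_apply_projection_eq hchar hBsymm hBnd
    hπ hadj (hzero π hhW) hiso
  obtain ⟨g₂, hg₂, hg₂U, hg₂W, hg₂S⟩ := exists_isometry_apply_projection_eq hchar hBsymm hBnd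
    hρρ hρadj (hzero ρ hhU) fun s hs t ht => by
      rw [hsplit hS' _ (hmemS' s hs) _ (hmemS' t ht), hsplit hS s hs t ht, hiso s hs t ht]
  refine ⟨g₂.trans g₁, fun x y => ?_, fun x hx => ?_, fun x hx => ?_, ?_⟩
  · rw [LinearEquiv.trans_apply, LinearEquiv.trans_apply, hg₁, hg₂]
  · rw [LinearEquiv.trans_apply, hg₂U x ((hρ0 x).2 hx), hg₁U x hx]
  · have h0 : π (g₂ x) = 0 := (hρ1 _).1 (hg₂W x ((hρ1 x).2 hx))
    rw [LinearEquiv.trans_apply, hg₁W _ h0, h0]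
  · rw [← hhS]
    refine map_eq_map_of_forall_mem_eq fun s hs => ?_
    have e1 : g₂ (π s) = π s := hg₂U _ ((hρ0 _).2 (hπ s))
    have e2 : g₁ (ρ (h s)) = ρ (h s) := hg₁W _ ((hρ1 _).1 (hρρ _))
    change g₁ (g₂ s) = h s
    rw [← hadd s, map_add, e1, hg₂S s hs, map_add, hg₁S s hs, e2, hadd, hadd]

end Orbits

/-- over an algebraically closed field of characteristic `≠ 2`, two
isotropic subspaces with the same invariants are in the same orbit of the symmetric
subgroup of the orthogonal group. -/
theorem stmt_11 (k : Type*) [Field k] [IsAlgClosed k] (hchar : (2 : k) ≠ 0)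
    (V : Type*) [AddCommGroup V] [Module k V] [FiniteDimensional k V]
    (B : LinearMap.BilinForm k V)
    (hBsymm : ∀ x y : V, B x y = B y x)
    (hBnd : ∀ x : V, (∀ y : V, B x y = 0) → x = 0)
    (U W : Submodule k V) (hUW : U ⊓ W = ⊥) (hUWtop : U ⊔ W = ⊤)
    (horth : ∀ u ∈ U, ∀ w ∈ W, B u w = 0)
    (S S' : Submodule k V)
    (hS : ∀ s ∈ S, ∀ s' ∈ S, B s s' = 0)
    (hS' : ∀ s ∈ S', ∀ s' ∈ S', B s s' = 0)
    (h1 : finrank k (S ⊓ U : Submodule k V) = finrank k (S' ⊓ U : Submodule k V))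
    (h2 : finrank k (S ⊓ W : Submodule k V) = finrank k (S' ⊓ W : Submodule k V))
    (h3 : finrank k (bilinRad B (projAlong W U S)) = finrank k (bilinRad B (projAlong W U S')))
    (h4 : finrank k (projAlong W U S) = finrank k (projAlong W U S')) :
    ∃ g : V ≃ₗ[k] V, (∀ x y : V, B (g x) (g y) = B x y) ∧
      Submodule.map (g : V →ₗ[k] V) U = U ∧
      Submodule.map (g : V →ₗ[k] V) W = W ∧
      Submodule.map (g : V →ₗ[k] V) S = S' := by
  have hc : IsCompl U W := ⟨disjoint_iff.2 hUW, codisjoint_iff.2 hUWtop⟩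
  set π : V →ₗ[k] V := U.projection W hc
  have hπU : ∀ x, π x ∈ U := fun x => Submodule.projection_apply_mem hc x
  have hπu : ∀ x, π x = x ↔ x ∈ U := fun x => Submodule.projection_eq_self_iff hc x
  have hπw : ∀ x, π x = 0 ↔ x ∈ W := fun x => Submodule.projection_apply_eq_zero_iff hc
  have hsub : ∀ x, x - π x ∈ W := fun x => Submodule.sub_projection_mem hc x
  have hππ : ∀ x, π (π x) = π x := fun x => (hπu _).2 (hπU x)
  have hadj : ∀ x y, B (π x) y = B x (π y) := by
    intro x y
    have e1 := horth (π x) (hπU x) (y - π y) (hsub y)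
    have e2 := horth (π y) (hπU y) (x - π x) (hsub x)
    rw [map_sub, sub_eq_zero] at e1 e2
    rw [e1, hBsymm x, e2, hBsymm]
  have hkerU : LinearMap.ker (LinearMap.id - π) = U := by
    ext x
    rw [← hπu, LinearMap.mem_ker, LinearMap.sub_apply, LinearMap.id_apply, sub_eq_zero, eq_comm]
  have hkerW : LinearMap.ker π = W := by
    ext x
    rw [← hπw, LinearMap.mem_ker]
  have hproj : ∀ T : Submodule k V, projAlong W U T = T.map π := by
    intro T
    ext x
    constructor
    · rintro ⟨hx, hxU⟩
      obtain ⟨t, ht, w, hw, rfl⟩ := Submodule.mem_sup.1 hx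
      refine ⟨t, ht, ?_⟩
      rw [← (hπu _).2 hxU, map_add, (hπw w).2 hw, add_zero]
    · rintro ⟨t, ht, rfl⟩
      refine ⟨Submodule.mem_sup.2 ⟨t, ht, -(t - π t), W.neg_mem (hsub t), by abel⟩, hπU t⟩
  have hrad : ∀ T : Submodule k V, bilinRad B (T.map π) = (bilinRad (B.comp π π) T).map π := by
    intro T
    ext x
    constructor
    · rintro ⟨⟨t, ht, rfl⟩, hx⟩
      exact ⟨t, ⟨ht, fun s hs => hx _ ⟨s, hs, rfl⟩⟩, rfl⟩
    · rintro ⟨t, ⟨ht, hx⟩, rfl⟩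
      refine ⟨⟨t, ht, rfl⟩, ?_⟩
      rintro _ ⟨s, hs, rfl⟩
      exact hx s hs
  have hinf : ∀ T : Submodule k V, bilinRad (B.comp π π) T ⊓ W = T ⊓ W := by
    intro T
    refine le_antisymm (inf_le_inf_right W inf_le_left) fun x hx => ⟨⟨hx.1, fun t _ => ?_⟩, hx.2⟩
    change B (π t) (π x) = 0
    rw [(hπw x).2 hx.2, map_zero]
  have hdS : ∀ T : Submodule k V,
      finrank k (projAlong W U T) + finrank k (T ⊓ W : Submodule k V) = finrank k T := by
    intro T
    rw [hproj, ← finrank_map_add_finrank_inf_ker π T, hkerW]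
  have hdR : ∀ T : Submodule k V, finrank k (bilinRad B (projAlong W U T)) +
      finrank k (T ⊓ W : Submodule k V) = finrank k (bilinRad (B.comp π π) T) := by
    intro T
    rw [hproj, hrad, ← finrank_map_add_finrank_inf_ker π (bilinRad _ T), hkerW, hinf]
  obtain ⟨g, hg, hgU, hgW, hgS⟩ := exists_isometry_commuting_projection_map_eq hchar hBsymm hBnd
    hππ hadj hS hS' (by rw [hkerU, h1]) (by rw [hkerW, h2]) (by rw [← hdR S, ← hdR S', h2, h3])
    (by rw [← hdS S, ← hdS S', h2, h4])
  have hmap : ∀ T : Submodule k V, (∀ x ∈ T, g x ∈ T) → T.map (g : V →ₗ[k] V) = T := by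
    intro T hT
    refine Submodule.eq_of_le_of_finrank_eq ?_ (LinearEquiv.finrank_map_eq g T)
    rintro _ ⟨x, hx, rfl⟩
    exact hT x hx
  exact ⟨g, hg, hmap U fun x hx => (hπu _).1 (hgU x ((hπu x).2 hx)),
    hmap W fun x hx => (hπw _).1 (hgW x ((hπw x).2 hx)), hgS⟩
end

section
/- Let (r_U, r_W, a, b) be natural numbers satisfying 2·r_U + 2·a + b ≤ dim U and 2·r_W + 2·a + b ≤ dim W. Then there exists an isotropic subspace S of V with dim(S ∩ U) = r_U, dim(S ∩ W) = r_W, dim Rad(proj_U S) = r_U + a, dim proj_U S = r_U + a + b, and dim S = r_U + r_W + a + b. -/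
open Module

open scoped Matrix

/-- A nondegenerate symmetric bilinear form over an algebraically closed field of characteristic
not two restricts to the dot product on the span of some vectors indexed by any finite type of
cardinality at most the dimension. -/
theorem exists_linearMap_apply_eq_dotProduct {k E ι : Type*} [Field k] [IsAlgClosed k]
    (hchar : (2 : k) ≠ 0) [AddCommGroup E] [Module k E] [FiniteDimensional k E] [Fintype ι]
    {B : LinearMap.BilinForm k E} (hB : B.IsSymm) (hnd : B.SeparatingLeft)
    (hι : Fintype.card ι ≤ finrank k E) :
    ∃ θ : (ι → k) →ₗ[k] E, ∀ x y, B (θ x) (θ y) = x ⬝ᵥ y := by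
  classical
  have := invertibleOfNonzero hchar
  obtain ⟨v, hv⟩ := LinearMap.BilinForm.exists_orthogonal_basis (B := B) ⟨hB.eq⟩
  have hv0 := hv.not_isOrtho_basis_self_of_separatingLeft hnd
  obtain ⟨e⟩ : Nonempty (ι ↪ Fin (finrank k E)) :=
    Function.Embedding.nonempty_of_card_le (by simpa using hι)
  choose c hc using fun i ↦ IsAlgClosed.exists_eq_mul_self (B (v i) (v i))
  have hc0 : ∀ i, c i ≠ 0 := fun i h ↦ hv0 i (by rw [hc, h, mul_zero])
  have hw : ∀ i j, B ((c (e i))⁻¹ • v (e i)) ((c (e j))⁻¹ • v (e j)) = if i = j then 1 else 0 := by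
    intro i j
    split_ifs with h
    · subst h
      have := hc0 (e i)
      simp only [map_smul, LinearMap.smul_apply, smul_eq_mul, hc]
      field_simp
    · have : B (v (e i)) (v (e j)) = 0 := hv (e.injective.ne h)
      simp [this]
  refine ⟨Fintype.linearCombination k fun i ↦ (c (e i))⁻¹ • v (e i), fun x y ↦ ?_⟩
  simp only [Fintype.linearCombination_apply, map_sum, map_smul _ (x _), map_smul _ (y _),
    LinearMap.sum_apply, LinearMap.smul_apply, hw, dotProduct]
  simp [mul_comm]

/-- A nondegenerate symmetric space of dimension at least `2 * r + 2 * s + b` contains the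
orthogonal sum of null spaces of dimensions `r` and `s` and the standard quadratic space of
dimension `b`. -/
theorem exists_injective_apply_eq_dotProduct {k E : Type*} [Field k] [IsAlgClosed k]
    (hchar : (2 : k) ≠ 0) [AddCommGroup E] [Module k E] [FiniteDimensional k E]
    {B : LinearMap.BilinForm k E} (hB : B.IsSymm) (hnd : B.SeparatingLeft) {r s b : ℕ}
    (h : 2 * r + 2 * s + b ≤ finrank k E) :
    ∃ φ : ((Fin r → k) × (Fin s → k) × (Fin b → k)) →ₗ[k] E,
      Function.Injective φ ∧ ∀ x y, B (φ x) (φ y) = x.2.2 ⬝ᵥ y.2.2 := by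
  obtain ⟨I, hI⟩ := IsAlgClosed.exists_eq_mul_self (-1 : k)
  obtain ⟨θ, hθ⟩ := exists_linearMap_apply_eq_dotProduct hchar hB hnd
    (ι := (Fin r ⊕ Fin s) ⊕ (Fin r ⊕ Fin s) ⊕ Fin b) (by simp; omega)
  have hθi : Function.Injective θ := by
    rw [injective_iff_map_eq_zero]
    intro x hx
    exact dotProduct_eq_zero x fun y ↦ by rw [← hθ, hx, map_zero, LinearMap.zero_apply]
  let g : ((Fin r → k) × (Fin s → k) × (Fin b → k)) →ₗ[k]
      ((Fin r ⊕ Fin s) ⊕ (Fin r ⊕ Fin s) ⊕ Fin b → k) :=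
    { toFun := fun x ↦ Sum.elim (Sum.elim x.1 x.2.1)
        (Sum.elim (Sum.elim (I • x.1) (I • x.2.1)) x.2.2)
      map_add' := fun x y ↦ by ext ((i | i) | (i | i) | i) <;> simp
      map_smul' := fun c x ↦ by ext ((i | i) | (i | i) | i) <;> simp [mul_left_comm] }
  refine ⟨θ ∘ₗ g, hθi.comp fun x y hxy ↦ ?_, fun x y ↦ ?_⟩
  · have hxy' : ∀ i, g x i = g y i := fun i ↦ congrFun hxy i
    refine Prod.ext (funext fun i ↦ hxy' (.inl (.inl i)))
      (Prod.ext (funext fun i ↦ hxy' (.inl (.inr i))) (funext fun i ↦ hxy' (.inr (.inr i))))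
  · simp only [LinearMap.comp_apply, hθ, g, LinearMap.coe_mk, AddHom.coe_mk,
      sumElim_dotProduct_sumElim, smul_dotProduct, dotProduct_smul, smul_eq_mul]
    linear_combination (-(x.1 ⬝ᵥ y.1) - x.2.1 ⬝ᵥ y.2.1) * hI

/-- The restriction of a nondegenerate symmetric form to an orthogonal direct summand is
nondegenerate. -/
theorem separatingLeft_restrict_of_sup_eq_top {k V : Type*} [Field k] [AddCommGroup V] [Module k V]
    {B : LinearMap.BilinForm k V} (hnd : B.SeparatingLeft) {U W : Submodule k V}
    (htop : U ⊔ W = ⊤) (horth : ∀ u ∈ U, ∀ w ∈ W, B u w = 0) :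
    (B.restrict U).SeparatingLeft := by
  rintro ⟨x, hx⟩ h
  refine Subtype.ext (hnd x fun y ↦ ?_)
  obtain ⟨u, hu, w, hw, rfl⟩ := Submodule.mem_sup.1 (htop ▸ Submodule.mem_top : y ∈ U ⊔ W)
  rw [map_add, horth x hx w hw, add_zero]
  exact h ⟨u, hu⟩

/-- Version of `exists_injective_apply_eq_dotProduct` inside an orthogonal direct summand. -/
theorem exists_injective_mem_apply_eq_dotProduct {k V : Type*} [Field k] [IsAlgClosed k]
    (hchar : (2 : k) ≠ 0) [AddCommGroup V] [Module k V] [FiniteDimensional k V]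
    {B : LinearMap.BilinForm k V} (hB : B.IsSymm) (hnd : B.SeparatingLeft) {U W : Submodule k V}
    (htop : U ⊔ W = ⊤) (horth : ∀ u ∈ U, ∀ w ∈ W, B u w = 0) {r s b : ℕ}
    (h : 2 * r + 2 * s + b ≤ finrank k U) :
    ∃ φ : ((Fin r → k) × (Fin s → k) × (Fin b → k)) →ₗ[k] V,
      Function.Injective φ ∧ (∀ x, φ x ∈ U) ∧ ∀ x y, B (φ x) (φ y) = x.2.2 ⬝ᵥ y.2.2 := by
  obtain ⟨φ, hφ, hφB⟩ := exists_injective_apply_eq_dotProduct hchar (B := B.restrict U)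
    ⟨fun x y ↦ hB.eq x y⟩ (separatingLeft_restrict_of_sup_eq_top hnd htop horth) h
  exact ⟨U.subtype ∘ₗ φ, U.injective_subtype.comp hφ, fun x ↦ (φ x).2, hφB⟩

/-- over an algebraically closed field of characteristic `≠ 2`, there
exists an isotropic subspace with prescribed invariants `(r_U, r_W, a, b)` subject to
`2r_U + 2a + b ≤ dim U` and `2r_W + 2a + b ≤ dim W`. -/
theorem stmt_12 (k : Type*) [Field k] [IsAlgClosed k] (hchar : (2 : k) ≠ 0)
    (V : Type*) [AddCommGroup V] [Module k V] [FiniteDimensional k V]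
    (B : LinearMap.BilinForm k V)
    (hBsymm : ∀ x y : V, B x y = B y x)
    (hBnd : ∀ x : V, (∀ y : V, B x y = 0) → x = 0)
    (U W : Submodule k V) (hUW : U ⊓ W = ⊥) (hUWtop : U ⊔ W = ⊤)
    (horth : ∀ u ∈ U, ∀ w ∈ W, B u w = 0)
    (rU rW a b : ℕ)
    (c1 : 2 * rU + 2 * a + b ≤ finrank k U)
    (c2 : 2 * rW + 2 * a + b ≤ finrank k W) :
    ∃ S : Submodule k V, (∀ s ∈ S, ∀ s' ∈ S, B s s' = 0) ∧
      finrank k (S ⊓ U : Submodule k V) = rU ∧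
      finrank k (S ⊓ W : Submodule k V) = rW ∧
      finrank k (bilinRad B (projAlong W U S)) = rU + a ∧
      finrank k (projAlong W U S) = rU + a + b ∧
      finrank k S = rU + rW + a + b := by
  obtain ⟨I, hI⟩ := IsAlgClosed.exists_eq_mul_self (-1 : k)
  have hI0 : I ≠ 0 := by rintro rfl; simp at hI
  have horth' : ∀ w ∈ W, ∀ u ∈ U, B w u = 0 := fun w hw u hu ↦ by rw [hBsymm, horth u hu w hw]
  obtain ⟨φ, hφ, hφU, hφB⟩ := exists_injective_mem_apply_eq_dotProduct hchar ⟨hBsymm⟩ hBnd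
    hUWtop horth c1
  obtain ⟨ψ, hψ, hψW, hψB⟩ := exists_injective_mem_apply_eq_dotProduct hchar ⟨hBsymm⟩ hBnd
    (sup_comm U W ▸ hUWtop) horth' c2
  have hdisj : ∀ v ∈ U, v ∈ W → v = 0 := fun v hU hW ↦ (Submodule.mem_bot k).1 (hUW ▸ ⟨hU, hW⟩)
  let Φ : ((Fin rU → k) × (Fin rW → k) × (Fin a → k) × (Fin b → k)) →ₗ[k] V :=
    φ ∘ₗ (LinearMap.id.prodMap (LinearMap.snd k _ _)) +
      ψ ∘ₗ (LinearMap.id.prodMap (LinearMap.id.prodMap (I • LinearMap.id))) ∘ₗ LinearMap.snd k _ _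
  have hΦ : ∀ x y p q, Φ (x, y, p, q) = φ (x, p, q) + ψ (y, p, I • q) := fun _ _ _ _ ↦ rfl
  have hΦU : ∀ x y p q, Φ (x, y, p, q) ∈ U → y = 0 ∧ p = 0 ∧ q = 0 := by
    intro x y p q h
    rw [hΦ, Submodule.add_mem_iff_right _ (hφU _)] at h
    have := (map_eq_zero_iff ψ hψ).1 (hdisj _ h (hψW _))
    simpa [hI0] using this
  have hΦW : ∀ x y p q, Φ (x, y, p, q) ∈ W → x = 0 ∧ p = 0 ∧ q = 0 := by
    intro x y p q h
    rw [hΦ, Submodule.add_mem_iff_left _ (hψW _)] at h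
    have := (map_eq_zero_iff φ hφ).1 (hdisj _ (hφU _) h)
    simpa using this
  have hΦi : Function.Injective Φ := by
    rw [injective_iff_map_eq_zero]
    rintro ⟨x, y, p, q⟩ h
    obtain ⟨rfl, rfl, rfl⟩ := hΦU x y p q (h ▸ U.zero_mem)
    obtain ⟨rfl, -, -⟩ := hΦW x 0 0 0 (h ▸ W.zero_mem)
    rfl
  have hproj : projAlong W U (LinearMap.range Φ) = LinearMap.range φ := by
    ext v
    constructor
    · rintro ⟨hv, hvU⟩
      obtain ⟨_, ⟨⟨x, y, p, q⟩, rfl⟩, w, hw, rfl⟩ := Submodule.mem_sup.1 hv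
      rw [hΦ, add_assoc] at hvU ⊢
      rw [hdisj _ ((Submodule.add_mem_iff_right _ (hφU _)).1 hvU) (W.add_mem (hψW _) hw), add_zero]
      exact ⟨_, rfl⟩
    · rintro ⟨⟨x, p, q⟩, rfl⟩
      refine ⟨Submodule.mem_sup.2 ⟨_, ⟨(x, 0, p, q), rfl⟩, -ψ (0, p, I • q),
        W.neg_mem (hψW _), ?_⟩, hφU _⟩
      rw [hΦ, add_neg_cancel_right]
  have hrad : bilinRad B (LinearMap.range φ) = LinearMap.range
      (φ ∘ₗ LinearMap.id.prodMap (LinearMap.inl k (Fin a → k) (Fin b → k))) := by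
    ext v
    constructor
    · rintro ⟨⟨⟨x, p, q⟩, rfl⟩, h⟩
      have hq : q = 0 := dotProduct_eq_zero q fun q' ↦ by
        have := h (φ (0, 0, q')) ⟨_, rfl⟩
        exact (dotProduct_comm _ _).trans ((hφB _ _).symm.trans this)
      subst hq
      exact ⟨(x, p), rfl⟩
    · rintro ⟨⟨x, p⟩, rfl⟩
      refine ⟨⟨(x, p, 0), rfl⟩, ?_⟩
      rintro _ ⟨y, rfl⟩
      exact (hφB _ _).trans (dotProduct_zero _)
  have hSU : LinearMap.range Φ ⊓ U = LinearMap.range (φ ∘ₗ LinearMap.inl k _ _) := by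
    ext v
    constructor
    · rintro ⟨⟨⟨x, y, p, q⟩, rfl⟩, h⟩
      obtain ⟨rfl, rfl, rfl⟩ := hΦU _ _ _ _ h
      refine ⟨x, ?_⟩
      rw [hΦ, smul_zero]
      exact (add_eq_left.2 (map_zero ψ)).symm
    · rintro ⟨x, rfl⟩
      refine ⟨⟨(x, 0, 0, 0), ?_⟩, hφU _⟩
      rw [hΦ, smul_zero]
      exact add_eq_left.2 (map_zero ψ)
  have hSW : LinearMap.range Φ ⊓ W = LinearMap.range (ψ ∘ₗ LinearMap.inl k _ _) := by
    ext v
    constructor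
    · rintro ⟨⟨⟨x, y, p, q⟩, rfl⟩, h⟩
      obtain ⟨rfl, rfl, rfl⟩ := hΦW _ _ _ _ h
      refine ⟨y, ?_⟩
      rw [hΦ, smul_zero]
      exact (add_eq_right.2 (map_zero φ)).symm
    · rintro ⟨y, rfl⟩
      refine ⟨⟨(0, y, 0, 0), ?_⟩, hψW _⟩
      rw [hΦ, smul_zero]
      exact add_eq_right.2 (map_zero φ)
  refine ⟨LinearMap.range Φ, ?_, ?_, ?_, ?_, ?_, ?_⟩
  · rintro _ ⟨⟨x, y, p, q⟩, rfl⟩ _ ⟨⟨x', y', p', q'⟩, rfl⟩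
    simp only [hΦ, map_add, LinearMap.add_apply, hφB, hψB, horth _ (hφU _) _ (hψW _),
      horth' _ (hψW _) _ (hφU _), smul_dotProduct, dotProduct_smul, smul_eq_mul]
    linear_combination (-(q ⬝ᵥ q')) * hI
  · rw [hSU, LinearMap.finrank_range_of_inj]
    · simp
    · exact hφ.comp LinearMap.inl_injective
  · rw [hSW, LinearMap.finrank_range_of_inj]
    · simp
    · exact hψ.comp LinearMap.inl_injective
  · rw [hproj, hrad, LinearMap.finrank_range_of_inj]
    · simp
    · exact hφ.comp (Function.injective_id.prodMap LinearMap.inl_injective)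
  · rw [hproj, LinearMap.finrank_range_of_inj hφ]
    simp [add_assoc]
  · rw [LinearMap.finrank_range_of_inj hΦi]
    simp [add_assoc]
end

section
/- Let S and S' be isotropic subspaces of V such that dim(S ∩ U) = dim(S' ∩ U), dim(S ∩ W) = dim(S' ∩ W), dim Rad(proj_U S) = dim Rad(proj_U S'), and dim proj_U S = dim proj_U S'. Then there exists a linear automorphism g of V with B(g x, g y) = B(x, y) for all x, y ∈ V, g(U) = U, g(W) = W, and g(S) = S'. -/
open Module

theorem LinearMap.range_flip_eq_dualAnnihilator_ker {K M N : Type*} [Field K]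
    [AddCommGroup M] [Module K M] [AddCommGroup N] [Module K N] [FiniteDimensional K N]
    (L : M →ₗ[K] Dual K N) : L.flip.range = L.ker.dualAnnihilator := by
  have : L.flip = L.dualMap ∘ₗ (evalEquiv K N : N →ₗ[K] Dual K (Dual K N)) := by
    ext; simp
  rw [this, LinearMap.range_comp_of_range_eq_top _ (LinearEquiv.range _),
    LinearMap.range_dualMap_eq_dualAnnihilator_ker]

theorem Submodule.finrank_map_add_finrank_inf_ker {K M N : Type*} [Field K]
    [AddCommGroup M] [Module K M] [AddCommGroup N] [Module K N] [FiniteDimensional K M]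
    (f : M →ₗ[K] N) (P : Submodule K M) :
    finrank K (P.map f) + finrank K (P ⊓ f.ker : Submodule K M) = finrank K P := by
  have := (f.domRestrict P).finrank_range_add_finrank_ker
  rwa [LinearMap.range_domRestrict, LinearMap.ker_domRestrict,
    ← Submodule.finrank_map_subtype_eq, Submodule.map_comap_subtype] at this

namespace LinearMap.BilinForm

variable {K E E' : Type*} [Field K] [AddCommGroup E] [Module K E]
  [AddCommGroup E'] [Module K E']

/-- The restriction of `f` to `P` is an injective isometry that preserves and reflects membership
in the kernels of the two forms. -/
structure IsPartialIsometry (b : LinearMap.BilinForm K E) (b' : LinearMap.BilinForm K E')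
    (P : Submodule K E) (f : E →ₗ[K] E') : Prop where
  injOn : ∀ x ∈ P, f x = 0 → x = 0
  apply_apply : ∀ x ∈ P, ∀ y ∈ P, b' (f x) (f y) = b x y
  mem_ker_iff : ∀ x ∈ P, f x ∈ b'.ker ↔ x ∈ b.ker

variable {b : LinearMap.BilinForm K E} {b' : LinearMap.BilinForm K E'}
  {P : Submodule K E} {f : E →ₗ[K] E'}

theorem IsPartialIsometry.finrank_map [FiniteDimensional K E]
    (hf : IsPartialIsometry b b' P f) {Q : Submodule K E} (hQ : Q ≤ P) :
    finrank K (Q.map f) = finrank K Q := by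
  have h := Submodule.finrank_map_add_finrank_inf_ker f Q
  have h0 : Q ⊓ f.ker = ⊥ := by
    rw [eq_bot_iff]
    rintro x ⟨hx, hx'⟩
    exact hf.injOn x (hQ hx) hx'
  rwa [h0, finrank_bot, add_zero] at h

/-- A partial isometry `f` on `P` extends to `P ⊔ span {v}` by sending `v` to `v'`. -/
theorem IsPartialIsometry.exists_extend_singleton (hb : b.IsAlt) (hb' : b'.IsAlt)
    (hf : IsPartialIsometry b b' P f) {v : E} {v' : E'} (hv : v ∉ P) (hv' : v' ∉ P.map f)
    (hvv' : ∀ p ∈ P, b' (f p) v' = b p v)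
    (hker : ∀ p ∈ P, f p + v' ∈ b'.ker ↔ p + v ∈ b.ker) :
    ∃ f' : E →ₗ[K] E', IsPartialIsometry b b' (P ⊔ K ∙ v) f' ∧ ∀ p ∈ P, f' p = f p := by
  obtain ⟨φ, hφv, hφ⟩ := Submodule.exists_le_ker_of_notMem hv
  have hφP : ∀ p ∈ P, φ p = 0 := fun p hp => hφ hp
  let f' : E →ₗ[K] E' := f + ((φ v)⁻¹ • φ).smulRight (v' - f v)
  have hf'P : ∀ p ∈ P, f' p = f p := fun p hp => by simp [f', hφP p hp]
  have hf'v : f' v = v' := by simp [f', hφv]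
  have hf' : ∀ p ∈ P, ∀ t : K, f' (p + t • v) = f p + t • v' := fun p hp t => by
    rw [map_add, map_smul, hf'P p hp, hf'v]
  have hmem : ∀ x ∈ P ⊔ K ∙ v, ∃ p ∈ P, ∃ t : K, x = p + t • v := fun x hx => by
    obtain ⟨p, hp, y, hy, rfl⟩ := Submodule.mem_sup.1 hx
    obtain ⟨t, rfl⟩ := Submodule.mem_span_singleton.1 hy
    exact ⟨p, hp, t, rfl⟩
  refine ⟨f', ⟨?_, ?_, ?_⟩, hf'P⟩
  · intro x hx h0
    obtain ⟨p, hp, t, rfl⟩ := hmem x hx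
    rw [hf' p hp] at h0
    obtain rfl | ht := eq_or_ne t 0
    · simpa using hf.injOn p hp (by simpa using h0)
    · refine absurd ⟨-(t⁻¹ • p), P.neg_mem (P.smul_mem _ hp), ?_⟩ hv'
      rw [map_neg, map_smul, eq_neg_of_add_eq_zero_left h0, smul_neg, neg_neg, inv_smul_smul₀ ht]
  · intro x hx y hy
    obtain ⟨p, hp, s, rfl⟩ := hmem x hx
    obtain ⟨q, hq, t, rfl⟩ := hmem y hy
    have h2 : b' v' (f q) = b v q := by rw [← hb'.neg_eq, ← hb.neg_eq, hvv' q hq]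
    simp [hf' p hp, hf' q hq, hf.apply_apply p hp q hq, hvv' p hp, h2, hb.self_eq_zero,
      hb'.self_eq_zero]
  · intro x hx
    obtain ⟨p, hp, t, rfl⟩ := hmem x hx
    rw [hf' p hp]
    obtain rfl | ht := eq_or_ne t 0
    · simpa using hf.mem_ker_iff p hp
    · have h := hker _ (P.smul_mem t⁻¹ hp)
      rw [← Submodule.smul_mem_iff _ ht, ← Submodule.smul_mem_iff (b.ker) ht] at h
      simpa [smul_smul, ht] using h

variable [FiniteDimensional K E]

theorem IsPartialIsometry.exists_extend_of_mem_ker (hb : b.IsAlt) (hb' : b'.IsAlt)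
    (hfr : finrank K b.ker = finrank K b'.ker)
    (hf : IsPartialIsometry b b' P f) {v : E} (hvb : v ∈ b.ker) (hv : v ∉ P) :
    ∃ f' : E →ₗ[K] E', IsPartialIsometry b b' (P ⊔ K ∙ v) f' ∧ ∀ p ∈ P, f' p = f p := by
  obtain ⟨v', hv'b, hv'⟩ : ∃ v' ∈ b'.ker, v' ∉ P.map f := by
    by_contra! H
    have hle : b'.ker ≤ (P ⊓ b.ker).map f := fun y hy => by
      obtain ⟨p, hp, rfl⟩ := H y hy
      exact ⟨p, ⟨hp, (hf.mem_ker_iff p hp).1 hy⟩, rfl⟩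
    have := Submodule.finrank_mono hle
    rw [hf.finrank_map inf_le_left, ← hfr] at this
    have := Submodule.eq_of_le_of_finrank_le inf_le_right this
    exact hv (this.ge hvb).1
  have hz : ∀ p, b p v = 0 := fun p => by
    rw [← hb.neg_eq, LinearMap.mem_ker.1 hvb]; simp
  have hz' : ∀ p, b' p v' = 0 := fun p => by
    rw [← hb'.neg_eq, LinearMap.mem_ker.1 hv'b]; simp
  refine hf.exists_extend_singleton hb hb' hv hv' (fun p _ => by rw [hz, hz']) fun p hp => ?_
  rw [Submodule.add_mem_iff_left _ hv'b, Submodule.add_mem_iff_left _ hvb, hf.mem_ker_iff p hp]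

variable [FiniteDimensional K E']

theorem IsPartialIsometry.map_ker (hf : IsPartialIsometry b b' P f)
    (hfr : finrank K b.ker = finrank K b'.ker) (hP : b.ker ≤ P) : b.ker.map f = b'.ker := by
  refine Submodule.eq_of_le_of_finrank_eq ?_ ((hf.finrank_map hP).trans hfr)
  rintro _ ⟨x, hx, rfl⟩
  exact (hf.mem_ker_iff x (hP hx)).2 hx

theorem IsPartialIsometry.exists_extend_of_ker_le (hb : b.IsAlt) (hb' : b'.IsAlt)
    (hE : finrank K E = finrank K E') (hfr : finrank K b.ker = finrank K b'.ker)
    (hf : IsPartialIsometry b b' P f) (hP : b.ker ≤ P) {v : E} (hv : v ∉ P) :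
    ∃ f' : E →ₗ[K] E', IsPartialIsometry b b' (P ⊔ K ∙ v) f' ∧ ∀ p ∈ P, f' p = f p := by
  have hK := hf.map_ker hfr hP
  let L : P →ₗ[K] Dual K E := b ∘ₗ P.subtype
  let L' : P →ₗ[K] Dual K E' := b' ∘ₗ f ∘ₗ P.subtype
  have hker : L'.ker = L.ker := by
    ext p
    exact hf.mem_ker_iff p p.2
  have hrange : L'.flip.range = L.flip.range := by
    rw [range_flip_eq_dualAnnihilator_ker, range_flip_eq_dualAnnihilator_ker, hker]
  have hkerfr : finrank K L'.flip.ker = finrank K L.flip.ker := by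
    have h1 := L'.flip.finrank_range_add_finrank_ker
    have h2 := L.flip.finrank_range_add_finrank_ker
    rw [hrange] at h1
    omega
  obtain ⟨w, hw⟩ : L.flip v ∈ L'.flip.range := hrange ▸ ⟨v, rfl⟩
  obtain ⟨v', hv', hv'P⟩ : ∃ v', L'.flip v' = L.flip v ∧ v' ∉ P.map f := by
    by_contra! H
    have hsub : L'.flip.ker ≤ P.map f := fun y hy => by
      have := (P.map f).sub_mem (H (w + y) (by rw [map_add, hw, hy, add_zero])) (H w hw)
      simpa using this
    have hle : L'.flip.ker ≤ (P ⊓ L.flip.ker).map f := fun y hy => by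
      obtain ⟨p, hp, rfl⟩ := hsub hy
      refine ⟨p, ⟨hp, ?_⟩, rfl⟩
      ext q
      exact (hf.apply_apply q q.2 p hp).symm.trans (LinearMap.congr_fun hy q)
    have hPL : P ⊓ L.flip.ker = L.flip.ker := by
      refine Submodule.eq_of_le_of_finrank_le inf_le_right ?_
      rw [← hkerfr, ← hf.finrank_map inf_le_left]
      exact Submodule.finrank_mono hle
    obtain ⟨p, hp, rfl⟩ := H w hw
    have hvp : v - p ∈ L.flip.ker := by
      rw [LinearMap.mem_ker, map_sub, ← hw, sub_eq_zero]
      ext q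
      exact hf.apply_apply q q.2 p hp
    rw [← hPL] at hvp
    exact hv (by simpa using P.add_mem hvp.1 hp)
  refine hf.exists_extend_singleton hb hb' hv hv'P
    (fun p hp => LinearMap.congr_fun hv' ⟨p, hp⟩) fun p hp => iff_of_false ?_ ?_
  · rw [← hK]
    exact fun h => hv'P (((P.map f).add_mem_iff_right ⟨p, hp, rfl⟩).1 (Submodule.map_mono hP h))
  · exact fun h => hv ((P.add_mem_iff_right hp).1 (hP h))

/-- **Witt's extension theorem** for (possibly degenerate) alternating forms. -/
theorem IsPartialIsometry.exists_linearEquiv (hb : b.IsAlt) (hb' : b'.IsAlt)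
    (hE : finrank K E = finrank K E') (hfr : finrank K b.ker = finrank K b'.ker)
    (hf : IsPartialIsometry b b' P f) :
    ∃ g : E ≃ₗ[K] E', (∀ x y, b' (g x) (g y) = b x y) ∧ ∀ p ∈ P, g p = f p := by
  induction P using WellFoundedGT.induction generalizing f with
  | _ P ih
  by_cases hP : P = ⊤
  · subst hP
    have hinj : Function.Injective f :=
      (injective_iff_map_eq_zero f).2 fun x => hf.injOn x trivial
    exact ⟨LinearEquiv.ofInjectiveOfFinrankEq f hinj hE,
      fun x y => hf.apply_apply x trivial y trivial, fun _ _ => rfl⟩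
  · obtain ⟨v, hv, f', hf', hf'P⟩ : ∃ v ∉ P, ∃ f' : E →ₗ[K] E',
        IsPartialIsometry b b' (P ⊔ K ∙ v) f' ∧ ∀ p ∈ P, f' p = f p := by
      by_cases hker : b.ker ≤ P
      · obtain ⟨v, -, hv⟩ := SetLike.exists_of_lt (lt_top_iff_ne_top.2 hP)
        exact ⟨v, hv, hf.exists_extend_of_ker_le hb hb' hE hfr hker hv⟩
      · obtain ⟨v, hvb, hv⟩ := SetLike.not_le_iff_exists.1 hker
        exact ⟨v, hv, hf.exists_extend_of_mem_ker hb hb' hfr hvb hv⟩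
    have hlt : P < P ⊔ K ∙ v := left_lt_sup.2 fun h =>
      hv (h (Submodule.mem_span_singleton_self v))
    obtain ⟨g, hg, hgP⟩ := ih _ hlt hf'
    exact ⟨g, hg, fun p hp => (hgP p (le_sup_left (a := P) hp)).trans (hf'P p hp)⟩

/-- Two alternating forms of the same dimension and rank are isometric, by an isometry matching
given pairs of disjoint subspaces of the kernels. -/
theorem exists_linearEquiv_of_le_ker (hb : b.IsAlt) (hb' : b'.IsAlt)
    (hE : finrank K E = finrank K E') (hfr : finrank K b.ker = finrank K b'.ker)
    {A C : Submodule K E} {A' C' : Submodule K E'} (hA : A ≤ b.ker) (hC : C ≤ b.ker)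
    (hA' : A' ≤ b'.ker) (hC' : C' ≤ b'.ker) (hAC : Disjoint A C) (hAC' : Disjoint A' C')
    (hAA' : finrank K A = finrank K A') (hCC' : finrank K C = finrank K C') :
    ∃ g : E ≃ₗ[K] E', (∀ x y, b' (g x) (g y) = b x y) ∧
      A.map (g : E →ₗ[K] E') = A' ∧ C.map (g : E →ₗ[K] E') = C' := by
  let a := LinearEquiv.ofFinrankEq A A' hAA'
  let c := LinearEquiv.ofFinrankEq C C' hCC'
  obtain ⟨D, hAD, hDC⟩ := hAC.exists_isCompl
  obtain ⟨α, hα⟩ := (A'.subtype ∘ₗ a.toLinearMap).exists_extend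
  let f : E →ₗ[K] E' := LinearMap.ofIsCompl hDC (α.domRestrict D) (C'.subtype ∘ₗ c.toLinearMap)
  have hfA : ∀ x : A, f x = a x := fun x =>
    (LinearMap.ofIsCompl_apply_left hDC ⟨x, hAD x.2⟩).trans (LinearMap.congr_fun hα x)
  have hfC : ∀ x : C, f x = c x := fun x => LinearMap.ofIsCompl_apply_right hDC x
  have hmem : ∀ x ∈ A ⊔ C, ∃ (y : A) (z : C), x = y + z := fun x hx => by
    obtain ⟨y, hy, z, hz, rfl⟩ := Submodule.mem_sup.1 hx
    exact ⟨⟨y, hy⟩, ⟨z, hz⟩, rfl⟩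
  have hle : A ⊔ C ≤ b.ker := sup_le hA hC
  have hfle : ∀ x ∈ A ⊔ C, f x ∈ b'.ker := fun x hx => by
    obtain ⟨y, z, rfl⟩ := hmem x hx
    rw [map_add, hfA, hfC]
    exact b'.ker.add_mem (hA' (a y).2) (hC' (c z).2)
  have hf : IsPartialIsometry b b' (A ⊔ C) f := by
    refine ⟨fun x hx h0 => ?_, fun x hx y _ => ?_, fun x hx => iff_of_true (hfle x hx) (hle hx)⟩
    · obtain ⟨y, z, rfl⟩ := hmem x hx
      rw [map_add, hfA, hfC] at h0
      have hy : (a y : E') = 0 := Submodule.disjoint_def.1 hAC' _ (a y).2 <| by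
        rw [eq_neg_of_add_eq_zero_left h0]
        exact C'.neg_mem (c z).2
      rw [hy, zero_add] at h0
      simp only [ZeroMemClass.coe_eq_zero, LinearEquiv.map_eq_zero_iff] at hy h0
      simp [hy, h0]
    · rw [LinearMap.mem_ker.1 (hfle x hx), LinearMap.mem_ker.1 (hle hx)]
      rfl
  obtain ⟨g, hg, hgf⟩ := hf.exists_linearEquiv hb hb' hE hfr
  refine ⟨g, hg, ?_, ?_⟩
  · refine Submodule.eq_of_le_of_finrank_eq ?_ ((LinearEquiv.finrank_map_eq g A).trans hAA')
    rintro _ ⟨x, hx, rfl⟩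
    have := (hgf x (le_sup_left (a := A) hx)).trans (hfA ⟨x, hx⟩)
    exact this ▸ (a ⟨x, hx⟩).2
  · refine Submodule.eq_of_le_of_finrank_eq ?_ ((LinearEquiv.finrank_map_eq g C).trans hCC')
    rintro _ ⟨x, hx, rfl⟩
    have := (hgf x (le_sup_right (a := A) hx)).trans (hfC ⟨x, hx⟩)
    exact this ▸ (c ⟨x, hx⟩).2

/-- An isometry between the forms pulled back along `α` and `α'` to `T` and `T'` is induced by a
self-isometry of the nondegenerate alternating form `b`, if it matches the kernels. -/
theorem exists_linearEquiv_apply_eq {T T' : Type*} [AddCommGroup T] [Module K T]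
    [AddCommGroup T'] [Module K T'] (hb : b.IsAlt) (hker : b.ker = ⊥)
    (α : T →ₗ[K] E) (α' : T' →ₗ[K] E) (h : T →ₗ[K] T')
    (hh : ∀ x y, b (α' (h x)) (α' (h y)) = b (α x) (α y)) (h0 : ∀ x, α' (h x) = 0 ↔ α x = 0) :
    ∃ g : E ≃ₗ[K] E, (∀ x y, b (g x) (g y) = b x y) ∧ ∀ x, g (α x) = α' (h x) := by
  obtain ⟨σ, hσ⟩ := α.rangeRestrict.exists_rightInverse_of_surjective α.range_rangeRestrict
  obtain ⟨f, hf⟩ := (α' ∘ₗ h ∘ₗ σ).exists_extend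
  have hασ : ∀ y, α (σ y) = y := fun y => congrArg Subtype.val (LinearMap.congr_fun hσ y)
  have hfα : ∀ x, f (α x) = α' (h x) := fun x => by
    refine (LinearMap.congr_fun hf (α.rangeRestrict x)).trans ?_
    refine sub_eq_zero.1 ?_
    simp only [LinearMap.comp_apply, ← map_sub]
    rw [h0, map_sub, hασ]
    exact sub_self _
  have hiso : IsPartialIsometry b b α.range f := by
    refine ⟨?_, ?_, ?_⟩
    · rintro _ ⟨x, rfl⟩
      rw [hfα]
      exact (h0 x).1
    · rintro _ ⟨x, rfl⟩ _ ⟨y, rfl⟩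
      rw [hfα, hfα, hh]
    · rintro _ ⟨x, rfl⟩
      rw [hfα, hker, Submodule.mem_bot, Submodule.mem_bot, h0]
  obtain ⟨g, hg, hgf⟩ := hiso.exists_linearEquiv hb hb rfl rfl
  exact ⟨g, hg, fun x => (hgf _ ⟨x, rfl⟩).trans (hfα x)⟩

end LinearMap.BilinForm

section Projection

variable {K V : Type*} [Field K] [AddCommGroup V] [Module K V] {U W : Submodule K V}

theorem map_projection_eq_projAlong (h : IsCompl U W) (S : Submodule K V) :
    S.map (U.projection W h) = projAlong W U S := by
  ext x
  constructor
  · rintro ⟨s, hs, rfl⟩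
    refine ⟨?_, U.projection_apply_mem h s⟩
    rw [← sub_sub_cancel s (U.projection W h s)]
    exact Submodule.sub_mem _ (Submodule.mem_sup_left hs)
      (Submodule.mem_sup_right (Submodule.sub_projection_mem h s))
  · rintro ⟨hx, hxU⟩
    obtain ⟨s, hs, w, hw, rfl⟩ := Submodule.mem_sup.1 hx
    refine ⟨s, hs, ?_⟩
    rw [← Submodule.projection_apply_of_mem_left h hxU, map_add,
      (Submodule.projection_apply_eq_zero_iff h).2 hw, add_zero]

/-- The form on `S` obtained by restricting `B` to the `U`-components. -/
noncomputable def projForm (B : LinearMap.BilinForm K V) (h : IsCompl U W) (S : Submodule K V) :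
    LinearMap.BilinForm K S :=
  B.compl₁₂ (U.projection W h ∘ₗ S.subtype) (U.projection W h ∘ₗ S.subtype)

theorem projForm_apply (B : LinearMap.BilinForm K V) (h : IsCompl U W) (S : Submodule K V)
    (x y : S) : projForm B h S x y = B (U.projection W h x) (U.projection W h y) := rfl

variable [FiniteDimensional K V]

theorem finrank_projAlong_add_finrank_inf (h : IsCompl U W) (S : Submodule K V) :
    finrank K (projAlong W U S) + finrank K (S ⊓ W : Submodule K V) = finrank K S := by
  have := S.finrank_map_add_finrank_inf_ker (U.projection W h)
  rwa [map_projection_eq_projAlong, Submodule.ker_projection] at this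

theorem finrank_ker_projForm {B : LinearMap.BilinForm K V} (hB : B.IsAlt) (h : IsCompl U W)
    (S : Submodule K V) :
    finrank K (projForm B h S).ker =
      finrank K (bilinRad B (projAlong W U S)) + finrank K (S ⊓ W : Submodule K V) := by
  have hmap : ((projForm B h S).ker.map S.subtype).map (U.projection W h) =
      bilinRad B (projAlong W U S) := by
    rw [← map_projection_eq_projAlong h]
    ext x
    constructor
    · rintro ⟨_, ⟨s, hs, rfl⟩, rfl⟩
      refine ⟨⟨s, s.2, rfl⟩, ?_⟩
      rintro _ ⟨t, ht, rfl⟩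
      exact hB.isRefl _ _ (LinearMap.congr_fun hs ⟨t, ht⟩)
    · rintro ⟨⟨s, hs, rfl⟩, hx⟩
      refine ⟨s, ⟨⟨s, hs⟩, ?_, rfl⟩, rfl⟩
      ext t
      exact hB.isRefl _ _ (hx _ ⟨t, t.2, rfl⟩)
  have hinf : (projForm B h S).ker.map S.subtype ⊓ W = S ⊓ W := by
    ext x
    constructor
    · rintro ⟨⟨s, -, rfl⟩, hw⟩
      exact ⟨s.2, hw⟩
    · rintro ⟨hs, hw⟩
      refine ⟨⟨⟨x, hs⟩, ?_, rfl⟩, hw⟩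
      ext t
      simp [projForm_apply, (Submodule.projection_apply_eq_zero_iff h).2 hw]
  rw [← Submodule.finrank_map_subtype_eq,
    ← Submodule.finrank_map_add_finrank_inf_ker (U.projection W h), Submodule.ker_projection,
    hmap, hinf]

end Projection

/-- in the symplectic case, two isotropic subspaces with the same
invariants are in the same orbit of the symmetric subgroup. -/
theorem stmt_14 (V : Type*) [AddCommGroup V] [Module ℝ V] [FiniteDimensional ℝ V]
    (B : LinearMap.BilinForm ℝ V)
    (hBalt : ∀ x : V, B x x = 0)
    (hBnd : ∀ x : V, (∀ y : V, B x y = 0) → x = 0)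
    (U W : Submodule ℝ V) (hUW : U ⊓ W = ⊥) (hUWtop : U ⊔ W = ⊤)
    (horth : ∀ u ∈ U, ∀ w ∈ W, B u w = 0)
    (S S' : Submodule ℝ V)
    (hS : ∀ s ∈ S, ∀ s' ∈ S, B s s' = 0)
    (hS' : ∀ s ∈ S', ∀ s' ∈ S', B s s' = 0)
    (h1 : finrank ℝ (S ⊓ U : Submodule ℝ V) = finrank ℝ (S' ⊓ U : Submodule ℝ V))
    (h2 : finrank ℝ (S ⊓ W : Submodule ℝ V) = finrank ℝ (S' ⊓ W : Submodule ℝ V))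
    (h3 : finrank ℝ (bilinRad B (projAlong W U S)) = finrank ℝ (bilinRad B (projAlong W U S')))
    (h4 : finrank ℝ (projAlong W U S) = finrank ℝ (projAlong W U S')) :
    ∃ g : V ≃ₗ[ℝ] V, (∀ x y : V, B (g x) (g y) = B x y) ∧
      Submodule.map (g : V →ₗ[ℝ] V) U = U ∧
      Submodule.map (g : V →ₗ[ℝ] V) W = W ∧
      Submodule.map (g : V →ₗ[ℝ] V) S = S' := by
  have h : IsCompl U W := ⟨disjoint_iff.2 hUW, codisjoint_iff.2 hUWtop⟩
  have hB : B.IsAlt := hBalt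
  set p := U.projection W h with hp
  set q := W.projection U h.symm with hq
  have hpq : ∀ x, p x + q x = x := Submodule.projection_add_projection_eq_self h
  have hpU : ∀ x, p x ∈ U := Submodule.projection_apply_mem h
  have hqW : ∀ x, q x ∈ W := Submodule.projection_apply_mem h.symm
  have hp0 : ∀ x, p x = 0 ↔ x ∈ W := fun x => Submodule.projection_apply_eq_zero_iff h
  have hq0 : ∀ x, q x = 0 ↔ x ∈ U := fun x => Submodule.projection_apply_eq_zero_iff h.symm
  have horth' : ∀ w ∈ W, ∀ u ∈ U, B w u = 0 := fun w hw u hu => hB.isRefl _ _ (horth u hu w hw)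
  have hsplit : ∀ x y, B x y = B (p x) (p y) + B (q x) (q y) := fun x y => by
    conv_lhs => rw [← hpq x, ← hpq y]
    simp [horth _ (hpU x) _ (hqW y), horth' _ (hqW x) _ (hpU y)]
  have hkerU : (B.restrict U).ker = ⊥ := by
    refine (Submodule.eq_bot_iff _).2 fun u hu => Subtype.ext (hBnd u fun y => ?_)
    rw [← hpq y, map_add, horth u u.2 _ (hqW y), add_zero]
    exact LinearMap.congr_fun hu ⟨p y, hpU y⟩
  have hkerW : (B.restrict W).ker = ⊥ := by
    refine (Submodule.eq_bot_iff _).2 fun w hw => Subtype.ext (hBnd w fun y => ?_)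
    rw [← hpq y, map_add, horth' w w.2 _ (hpU y), zero_add]
    exact LinearMap.congr_fun hw ⟨q y, hqW y⟩
  have hdim : finrank ℝ S = finrank ℝ S' := by
    rw [← finrank_projAlong_add_finrank_inf h, ← finrank_projAlong_add_finrank_inf h S', h2, h4]
  have hle : ∀ T : Submodule ℝ V, (∀ s ∈ T, ∀ t ∈ T, B s t = 0) →
      U.submoduleOf T ≤ (projForm B h T).ker ∧ W.submoduleOf T ≤ (projForm B h T).ker := by
    refine fun T hT => ⟨fun s hs => ?_, fun s hs => ?_⟩
    · ext t
      have := hT s s.2 t t.2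
      rwa [hsplit, (hq0 s).2 hs, map_zero, LinearMap.zero_apply, add_zero] at this
    · ext t
      rw [projForm_apply, ← hp, (hp0 s).2 hs, map_zero]
      rfl
  have hdisj : ∀ T : Submodule ℝ V, Disjoint (U.submoduleOf T) (W.submoduleOf T) := fun T =>
    Submodule.disjoint_def.2 fun x hx hx' => Subtype.ext (Submodule.disjoint_def.1 h.1 x hx hx')
  have hfr : ∀ X T : Submodule ℝ V,
      finrank ℝ (X.submoduleOf T) = finrank ℝ (T ⊓ X : Submodule ℝ V) := fun X T => by
    rw [← Submodule.finrank_map_subtype_eq, Submodule.submoduleOf, Submodule.map_comap_subtype]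
  obtain ⟨e, he, heU, heW⟩ := LinearMap.BilinForm.exists_linearEquiv_of_le_ker
    (b := projForm B h S) (b' := projForm B h S') (fun x => hBalt _) (fun x => hBalt _) hdim
    (by rw [finrank_ker_projForm hB, finrank_ker_projForm hB, h2, h3])
    (hle S hS).1 (hle S hS).2 (hle S' hS').1 (hle S' hS').2 (hdisj S) (hdisj S')
    (by rw [hfr, hfr, h1]) (by rw [hfr, hfr, h2])
  have hmem : ∀ X : Submodule ℝ V,
      (X.submoduleOf S).map (e : S →ₗ[ℝ] S') = X.submoduleOf S' →
      ∀ s : S, (e s : V) ∈ X ↔ (s : V) ∈ X := fun X hX s => by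
    have : e s ∈ X.submoduleOf S' ↔ s ∈ X.submoduleOf S := by
      rw [← hX]
      exact e.injective.mem_set_image
    exact this
  have hep : ∀ s t : S, B (p (e s)) (p (e t)) = B (p s) (p t) := he
  have heq : ∀ s t : S, B (q (e s)) (q (e t)) = B (q s) (q t) := fun s t => by
    have h1 := hsplit s t
    have h2 := hsplit (e s) (e t)
    rw [hS s s.2 t t.2] at h1
    rw [hS' _ (e s).2 _ (e t).2, hep] at h2
    linarith
  obtain ⟨gU, hgU, hgUe⟩ := LinearMap.BilinForm.exists_linearEquiv_apply_eq (b := B.restrict U)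
    (fun x => hBalt x) hkerU (U.projectionOnto W h ∘ₗ S.subtype)
    (U.projectionOnto W h ∘ₗ S'.subtype) e.toLinearMap hep fun s => by
      simpa using hmem W heW s
  obtain ⟨gW, hgW, hgWe⟩ := LinearMap.BilinForm.exists_linearEquiv_apply_eq (b := B.restrict W)
    (fun x => hBalt x) hkerW (W.projectionOnto U h.symm ∘ₗ S.subtype)
    (W.projectionOnto U h.symm ∘ₗ S'.subtype) e.toLinearMap heq fun s => by
      simpa using hmem U heU s
  let c := Submodule.prodEquivOfIsCompl U W h
  let g : V ≃ₗ[ℝ] V := c.symm ≪≫ₗ (gU.prodCongr gW) ≪≫ₗ c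
  have hg : ∀ (u : U) (w : W), g (u + w) = gU u + gW w := fun u w => by
    have : c.symm (u + w) = (u, w) := c.symm_apply_eq.2 rfl
    simp [g, this, c]
  have hgu : ∀ u : U, g u = gU u := fun u => by simpa using hg u 0
  have hgw : ∀ w : W, g w = gW w := fun w => by simpa using hg 0 w
  have hmap : ∀ X Y : Submodule ℝ V, finrank ℝ X = finrank ℝ Y → (∀ x ∈ X, g x ∈ Y) →
      X.map (g : V →ₗ[ℝ] V) = Y := fun X Y hXY hX =>
    Submodule.eq_of_le_of_finrank_eq (Submodule.map_le_iff_le_comap.2 hX)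
      ((LinearEquiv.finrank_map_eq g X).trans hXY)
  refine ⟨g, fun x y => ?_, hmap U U rfl fun u hu => ?_, hmap W W rfl fun w hw => ?_,
    hmap S S' hdim fun s hs => ?_⟩
  · have key : ∀ (u u' : U) (w w' : W), B (g (u + w)) (g (u' + w')) = B (u + w) (u' + w') := by
      intro u u' w w'
      have hu : B (gU u) (gU u') = B u u' := hgU u u'
      have hw : B (gW w) (gW w') = B w w' := hgW w w'
      simp [hg, hu, hw, horth, horth']
    simpa only [hpq] using key ⟨p x, hpU x⟩ ⟨p y, hpU y⟩ ⟨q x, hqW x⟩ ⟨q y, hqW y⟩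
  · exact (hgu ⟨u, hu⟩).symm ▸ (gU ⟨u, hu⟩).2
  · exact (hgw ⟨w, hw⟩).symm ▸ (gW ⟨w, hw⟩).2
  · have h1 : (gU ⟨p s, hpU s⟩ : V) = p (e ⟨s, hs⟩) := congrArg Subtype.val (hgUe ⟨s, hs⟩)
    have h2 : (gW ⟨q s, hqW s⟩ : V) = q (e ⟨s, hs⟩) := congrArg Subtype.val (hgWe ⟨s, hs⟩)
    have h3 := hg ⟨p s, hpU s⟩ ⟨q s, hqW s⟩
    rw [h1, h2, hpq, hpq] at h3
    exact h3 ▸ (e ⟨s, hs⟩).2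
end

section
/- Let S₁ be the span of e₁ + i·e₂ + i·e₅ − e₆; let S₂ = S₁ + span(e₁ − i·e₂ + i·e₅ + e₆, e₃ − i·e₄ + i·e₇ + e₈); and let S₂' = S₁ + span(e₃ + i·e₄ + i·e₇ − e₈, e₃ − i·e₄ + i·e₇ + e₈), where i is the imaginary unit. Then: (1) there exists a linear automorphism h of V with B(h x, h y) = B(x, y) for all x, y, h(U) = U, h(W) = W, and h(S₂) = S₂'; but (2) there is no linear automorphism g of V with B(g x, g y) = B(x, y) for all x, y, g(U) = U, g(W) = W, g(S₁) = S₁, and g(S₂) = S₂'. -/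
open Module

namespace Stmt18

/-- `V = ℂ⁸`. -/
abbrev V : Type := Fin 8 → ℂ

/-- The standard symmetric bilinear form `B x y = ∑ j, x j * y j` on `ℂ⁸`. -/
noncomputable def B (x y : V) : ℂ := ∑ j : Fin 8, x j * y j

/-- The standard basis vectors of `ℂ⁸` (indexed from `0` to `7`). -/
noncomputable def e (j : Fin 8) : V := Pi.single j 1

/-- `U = span(e₁, e₂, e₃, e₄)`. -/
noncomputable def U : Submodule ℂ V := Submodule.span ℂ {e 0, e 1, e 2, e 3}

/-- `W = span(e₅, e₆, e₇, e₈)`. -/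
noncomputable def W : Submodule ℂ V := Submodule.span ℂ {e 4, e 5, e 6, e 7}

/-- `S₁ = span(e₁ + i e₂ + i e₅ − e₆)`. -/
noncomputable def S₁ : Submodule ℂ V :=
  Submodule.span ℂ {e 0 + Complex.I • e 1 + Complex.I • e 4 - e 5}

/-- `S₂ = S₁ + span(e₁ − i e₂ + i e₅ + e₆, e₃ − i e₄ + i e₇ + e₈)`. -/
noncomputable def S₂ : Submodule ℂ V :=
  S₁ ⊔ Submodule.span ℂ {e 0 - Complex.I • e 1 + Complex.I • e 4 + e 5,
    e 2 - Complex.I • e 3 + Complex.I • e 6 + e 7}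

/-- `S₂' = S₁ + span(e₃ + i e₄ + i e₇ − e₈, e₃ − i e₄ + i e₇ + e₈)`. -/
noncomputable def S₂' : Submodule ℂ V :=
  S₁ ⊔ Submodule.span ℂ {e 2 + Complex.I • e 3 + Complex.I • e 6 - e 7,
    e 2 - Complex.I • e 3 + Complex.I • e 6 + e 7}

theorem mem_U_iff {x : V} : x ∈ U ↔ x 4 = 0 ∧ x 5 = 0 ∧ x 6 = 0 ∧ x 7 = 0 := by
  simp only [U, Submodule.mem_span_insert, Submodule.mem_span_singleton]
  constructor
  · rintro ⟨a, _, ⟨b, _, ⟨c, _, ⟨d, rfl⟩, rfl⟩, rfl⟩, rfl⟩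
    simp [e]
  · rintro ⟨h4, h5, h6, h7⟩
    refine ⟨x 0, _, ⟨x 1, _, ⟨x 2, _, ⟨x 3, rfl⟩, rfl⟩, rfl⟩, ?_⟩
    ext j
    fin_cases j <;> simp [e, h4, h5, h6, h7]

theorem mem_W_iff {x : V} : x ∈ W ↔ x 0 = 0 ∧ x 1 = 0 ∧ x 2 = 0 ∧ x 3 = 0 := by
  simp only [W, Submodule.mem_span_insert, Submodule.mem_span_singleton]
  constructor
  · rintro ⟨a, _, ⟨b, _, ⟨c, _, ⟨d, rfl⟩, rfl⟩, rfl⟩, rfl⟩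
    simp [e]
  · rintro ⟨h0, h1, h2, h3⟩
    refine ⟨x 4, _, ⟨x 5, _, ⟨x 6, _, ⟨x 7, rfl⟩, rfl⟩, rfl⟩, ?_⟩
    ext j
    fin_cases j <;> simp [e, h0, h1, h2, h3]

/-- The signed coordinate permutation sending `e₁, e₂, e₃, e₄` to `e₃, e₄, e₁, -e₂` and
`e₅, e₆, e₇, e₈` to `e₇, e₈, e₅, -e₆`. -/
noncomputable def signedSwap : V ≃ₗ[ℂ] V where
  toFun x := ![x 2, -x 3, x 0, x 1, x 6, -x 7, x 4, x 5]
  invFun x := ![x 2, x 3, x 0, -x 1, x 6, x 7, x 4, -x 5]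
  map_add' x y := by ext j; fin_cases j <;> simp [add_comm]
  map_smul' c x := by ext j; fin_cases j <;> simp
  left_inv x := by ext j; fin_cases j <;> simp
  right_inv x := by ext j; fin_cases j <;> simp

theorem signedSwap_apply (x : V) :
    signedSwap x = ![x 2, -x 3, x 0, x 1, x 6, -x 7, x 4, x 5] := rfl

theorem signedSwap_symm_apply (x : V) :
    signedSwap.symm x = ![x 2, x 3, x 0, -x 1, x 6, x 7, x 4, -x 5] := rfl

theorem B_signedSwap (x y : V) : B (signedSwap x) (signedSwap y) = B x y := by
  simp only [B, signedSwap_apply, Fin.sum_univ_eight]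
  simp
  ring

theorem map_signedSwap_U : Submodule.map (signedSwap : V →ₗ[ℂ] V) U = U := by
  ext x
  rw [Submodule.map_equiv_eq_comap_symm, Submodule.mem_comap, mem_U_iff, mem_U_iff]
  simp [signedSwap_symm_apply]
  tauto

theorem map_signedSwap_W : Submodule.map (signedSwap : V →ₗ[ℂ] V) W = W := by
  ext x
  rw [Submodule.map_equiv_eq_comap_symm, Submodule.mem_comap, mem_W_iff, mem_W_iff]
  simp [signedSwap_symm_apply]
  tauto

theorem map_signedSwap_S₂ : Submodule.map (signedSwap : V →ₗ[ℂ] V) S₂ = S₂' := by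
  have h₁ : signedSwap (e 0 + Complex.I • e 1 + Complex.I • e 4 - e 5) =
      e 2 + Complex.I • e 3 + Complex.I • e 6 - e 7 := by
    rw [signedSwap_apply]; ext j; fin_cases j <;> simp [e]
  have h₂ : signedSwap (e 0 - Complex.I • e 1 + Complex.I • e 4 + e 5) =
      e 2 - Complex.I • e 3 + Complex.I • e 6 + e 7 := by
    rw [signedSwap_apply]; ext j; fin_cases j <;> simp [e]
  have h₃ : signedSwap (e 2 - Complex.I • e 3 + Complex.I • e 6 + e 7) =
      e 0 + Complex.I • e 1 + Complex.I • e 4 - e 5 := by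
    rw [signedSwap_apply]; ext j; fin_cases j <;> simp [e]
  simp only [S₂, S₂', S₁, Submodule.map_sup, Submodule.map_span, Set.image_insert_eq,
    Set.image_singleton, LinearEquiv.coe_coe, h₁, h₂, h₃]
  simp only [← Submodule.span_union]
  congr 1
  ext x
  simp only [Set.mem_union, Set.mem_insert_iff, Set.mem_singleton_iff]
  tauto

/-- The `U`-component `e₁ + i e₂` of the generator of `S₁` is orthogonal to `S₂'`. -/
theorem B_eq_zero_of_mem_S₂' {y : V} (hy : y ∈ S₂') : B (e 0 + Complex.I • e 1) y = 0 := by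
  simp only [S₂', S₁, Submodule.mem_sup, Submodule.mem_span_pair,
    Submodule.mem_span_singleton] at hy
  obtain ⟨_, ⟨a, rfl⟩, _, ⟨b, c, rfl⟩, rfl⟩ := hy
  simp [B, Fin.sum_univ_eight, e]
  linear_combination a * Complex.I_mul_I

/-- An automorphism preserving `U`, `W` and `S₁` preserves the line of the `U`-component
`e₁ + i e₂` of the generator of `S₁`. -/
theorem exists_map_eq_smul {g : V ≃ₗ[ℂ] V}
    (hU : Submodule.map (g : V →ₗ[ℂ] V) U = U) (hW : Submodule.map (g : V →ₗ[ℂ] V) W = W)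
    (hS : Submodule.map (g : V →ₗ[ℂ] V) S₁ = S₁) :
    ∃ c : ℂ, g (e 0 + Complex.I • e 1) = c • (e 0 + Complex.I • e 1) := by
  have hgU : g (e 0 + Complex.I • e 1) ∈ U := by
    rw [← hU]
    exact Submodule.mem_map_of_mem (mem_U_iff.2 (by simp [e]))
  have hgW : g (Complex.I • e 4 - e 5) ∈ W := by
    rw [← hW]
    exact Submodule.mem_map_of_mem (mem_W_iff.2 (by simp [e]))
  have hgS : g (e 0 + Complex.I • e 1 + Complex.I • e 4 - e 5) ∈ S₁ := by
    rw [← hS]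
    exact Submodule.mem_map_of_mem (Submodule.mem_span_singleton_self _)
  obtain ⟨c, hc⟩ := Submodule.mem_span_singleton.1 hgS
  rw [add_sub_assoc, map_add] at hc
  obtain ⟨u4, u5, u6, u7⟩ := mem_U_iff.1 hgU
  obtain ⟨w0, w1, w2, w3⟩ := mem_W_iff.1 hgW
  refine ⟨c, ?_⟩
  generalize g (e 0 + Complex.I • e 1) = u at *
  generalize g (Complex.I • e 4 - e 5) = w at *
  ext j
  have hj := congrFun hc j
  fin_cases j
  iterate 4 simpa [e, w0, w1, w2, w3] using hj.symm
  all_goals simp [e, u4, u5, u6, u7]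

/-- there is an isometry preserving `U` and `W` taking `S₂` to `S₂'`,
but no such isometry which in addition fixes `S₁` takes `S₂` to `S₂'`. -/
theorem stmt_18 :
    (∃ h : V ≃ₗ[ℂ] V, (∀ x y : V, B (h x) (h y) = B x y) ∧
      Submodule.map (h : V →ₗ[ℂ] V) U = U ∧
      Submodule.map (h : V →ₗ[ℂ] V) W = W ∧
      Submodule.map (h : V →ₗ[ℂ] V) S₂ = S₂') ∧
    ¬ (∃ g : V ≃ₗ[ℂ] V, (∀ x y : V, B (g x) (g y) = B x y) ∧
      Submodule.map (g : V →ₗ[ℂ] V) U = U ∧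
      Submodule.map (g : V →ₗ[ℂ] V) W = W ∧
      Submodule.map (g : V →ₗ[ℂ] V) S₁ = S₁ ∧
      Submodule.map (g : V →ₗ[ℂ] V) S₂ = S₂') := by
  refine ⟨⟨signedSwap, B_signedSwap, map_signedSwap_U, map_signedSwap_W, map_signedSwap_S₂⟩, ?_⟩
  rintro ⟨g, hB, hU, hW, hS₁, hS₂⟩
  obtain ⟨c, hc⟩ := exists_map_eq_smul hU hW hS₁
  set y : V := e 0 - Complex.I • e 1 + Complex.I • e 4 + e 5 with hy
  have hgy : g y ∈ S₂' := by
    rw [← hS₂]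
    exact Submodule.mem_map_of_mem
      (Submodule.mem_sup_right (Submodule.subset_span (Set.mem_insert _ _)))
  have hzero : B (g (e 0 + Complex.I • e 1)) (g y) = 0 := by
    rw [hc]
    have hsmul : B (c • (e 0 + Complex.I • e 1)) (g y) = c * B (e 0 + Complex.I • e 1) (g y) := by
      simp only [B, Finset.mul_sum, Pi.smul_apply, smul_eq_mul, mul_assoc]
    rw [hsmul, B_eq_zero_of_mem_S₂' hgy, mul_zero]
  have htwo : B (e 0 + Complex.I • e 1) y = 2 := by
    simp [hy, B, Fin.sum_univ_eight, e]
    norm_num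
  rw [hB, htwo] at hzero
  exact two_ne_zero hzero

end Stmt18
end
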